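/- arXiv:1905.06771 — 14 statements merged into one kernel-verified Lean document; each statement's English description precedes it below -/
import Mathlib

section
/- Let α < β be real numbers, let x₁,…,x_l ∈ [α,β], and let a₁,…,a_l ≥ 0 with Σ_{j=1}^l a_j = 1; set x̄ = Σ_{j=1}^l a_j x_j. If f : [α,β] → ℝ is strongly convex with modulus c > 0, then Σ_{j=1}^l a_j f(x_j) ≤ ((β − x̄)/(β − α)) f(α) + ((x̄ − α)/(β − α)) f(β) − c Σ_{j=1}^l a_j (β − x_j)(x_j − α). (Lah–Ribarič inequality for strongly convex functions.) -/
/-- A function satisfying the strong convexity inequality between the endpoints of an interval lies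
below its chord by at least the quadratic defect. -/
lemma le_chord_sub_of_strongly_convex_endpoints
    {α β y c : ℝ} {f : ℝ → ℝ} (hαβ : α < β) (hy : y ∈ Set.Icc α β)
    (hf : ∀ t ∈ Set.Icc (0:ℝ) 1,
      f (t * α + (1 - t) * β) ≤ t * f α + (1 - t) * f β - c * t * (1 - t) * (α - β) ^ 2) :
    f y ≤ (β - y) / (β - α) * f α + (y - α) / (β - α) * f β - c * (β - y) * (y - α) := by
  have hpos : 0 < β - α := sub_pos.2 hαβ
  have hne : β - α ≠ 0 := hpos.ne'
  have h := hf ((β - y) / (β - α))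
    ⟨div_nonneg (sub_nonneg.2 hy.2) hpos.le, (div_le_one hpos).2 (by linarith [hy.1])⟩
  have ht : 1 - (β - y) / (β - α) = (y - α) / (β - α) := by
    field_simp
    ring
  have hcomb : (β - y) / (β - α) * α + (y - α) / (β - α) * β = y := by
    field_simp
    ring
  have hquad : c * ((β - y) / (β - α)) * ((y - α) / (β - α)) * (α - β) ^ 2
      = c * (β - y) * (y - α) := by
    rw [← neg_sub β α, neg_sq]
    field_simp
  rwa [ht, hcomb, hquad] at h

/-- Lah–Ribarič inequality for strongly convex functions. -/
theorem lah_ribaric_strongly_convex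
    (α β : ℝ) (hαβ : α < β) (l : ℕ)
    (x : Fin l → ℝ) (hx : ∀ j, x j ∈ Set.Icc α β)
    (a : Fin l → ℝ) (ha : ∀ j, 0 ≤ a j) (hsum : ∑ j, a j = 1)
    (f : ℝ → ℝ) (c : ℝ) (hc : 0 < c)
    (hf : ∀ u ∈ Set.Icc α β, ∀ v ∈ Set.Icc α β, ∀ t ∈ Set.Icc (0:ℝ) 1,
      f (t * u + (1 - t) * v) ≤ t * f u + (1 - t) * f v - c * t * (1 - t) * (u - v) ^ 2) :
    ∑ j, a j * f (x j) ≤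
      ((β - ∑ j, a j * x j) / (β - α)) * f α + (((∑ j, a j * x j) - α) / (β - α)) * f β
        - c * ∑ j, a j * (β - x j) * (x j - α) := by
  have hend := hf α (Set.left_mem_Icc.2 hαβ.le) β (Set.right_mem_Icc.2 hαβ.le)
  have hβ : β - ∑ j, a j * x j = ∑ j, a j * (β - x j) := by
    simp only [mul_sub, Finset.sum_sub_distrib, ← Finset.sum_mul, hsum, one_mul]
  have hα : (∑ j, a j * x j) - α = ∑ j, a j * (x j - α) := by
    simp only [mul_sub, Finset.sum_sub_distrib, ← Finset.sum_mul, hsum, one_mul]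
  rw [hβ, hα, Finset.sum_div, Finset.sum_div, Finset.sum_mul, Finset.sum_mul, Finset.mul_sum,
    ← Finset.sum_add_distrib, ← Finset.sum_sub_distrib]
  refine Finset.sum_le_sum fun j _ => ?_
  calc a j * f (x j)
      ≤ a j * ((β - x j) / (β - α) * f α + (x j - α) / (β - α) * f β
          - c * (β - x j) * (x j - α)) :=
        mul_le_mul_of_nonneg_left
          (le_chord_sub_of_strongly_convex_endpoints hαβ (hx j) hend) (ha j)
    _ = _ := by ring
end

section
/- Let α < β, x = (x₁,…,x_l) ∈ [α,β]^l, y = (y₁,…,y_m) ∈ [α,β]^m, a = (a₁,…,a_l) ∈ [0,∞)^l and b = (b₁,…,b_m) ∈ [0,∞)^m be such that (y,b) ≺ (x,a) in the weighted majorization sense. Then for every f : [α,β] → ℝ strongly convex with modulus c > 0, Σ_{i=1}^m b_i f(y_i) ≤ Σ_{j=1}^l a_j f(x_j) − c (Σ_{j=1}^l a_j x_j² − Σ_{i=1}^m b_i y_i²). (Sherman's inequality for strongly convex functions.) -/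
/-- Sherman's inequality for convex functions. -/
theorem ConvexOn.sherman {ι κ : Type*} [Fintype ι] [Fintype κ] {s : Set ℝ} {g : ℝ → ℝ}
    (hg : ConvexOn ℝ s g) {x : κ → ℝ} (hx : ∀ j, x j ∈ s) {b : ι → ℝ} (hb : ∀ i, 0 ≤ b i)
    {A : ι → κ → ℝ} (hA : ∀ i j, 0 ≤ A i j) (hArow : ∀ i, ∑ j, A i j = 1) :
    ∑ i, b i * g (∑ j, A i j * x j) ≤ ∑ j, (∑ i, b i * A i j) * g (x j) :=
  calc
    ∑ i, b i * g (∑ j, A i j * x j) ≤ ∑ i, b i * ∑ j, A i j * g (x j) :=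
      Finset.sum_le_sum fun i _ ↦ mul_le_mul_of_nonneg_left
        (hg.map_sum_le (fun j _ ↦ hA i j) (hArow i) fun j _ ↦ hx j) (hb i)
    _ = ∑ j, (∑ i, b i * A i j) * g (x j) := by
      simp only [Finset.mul_sum, Finset.sum_mul, mul_assoc]
      exact Finset.sum_comm

/-- Subtracting `c * u ^ 2` from a strongly convex function of modulus `c` leaves a convex
function. -/
theorem convexOn_sub_const_mul_sq {s : Set ℝ} (hs : Convex ℝ s) {f : ℝ → ℝ} {c : ℝ}
    (hf : ∀ u ∈ s, ∀ v ∈ s, ∀ t ∈ Set.Icc (0 : ℝ) 1,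
      f (t * u + (1 - t) * v) ≤ t * f u + (1 - t) * f v - c * t * (1 - t) * (u - v) ^ 2) :
    ConvexOn ℝ s fun u ↦ f u - c * u ^ 2 := by
  refine ⟨hs, fun u hu v hv p q hp hq hpq ↦ ?_⟩
  obtain rfl : q = 1 - p := by linarith
  have h := hf u hu v hv p ⟨hp, by linarith⟩
  simp only [smul_eq_mul]
  linear_combination h

/-- Sherman's inequality for strongly convex functions. -/
theorem sherman_strongly_convex
    (α β : ℝ) (hαβ : α < β) (l m : ℕ)
    (x : Fin l → ℝ) (hx : ∀ j, x j ∈ Set.Icc α β)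
    (y : Fin m → ℝ) (hy : ∀ i, y i ∈ Set.Icc α β)
    (a : Fin l → ℝ) (ha : ∀ j, 0 ≤ a j)
    (b : Fin m → ℝ) (hb : ∀ i, 0 ≤ b i)
    (A : Fin m → Fin l → ℝ) (hA : ∀ i j, 0 ≤ A i j) (hArow : ∀ i, ∑ j, A i j = 1)
    (haA : ∀ j, a j = ∑ i, b i * A i j) (hyA : ∀ i, y i = ∑ j, A i j * x j)
    (f : ℝ → ℝ) (c : ℝ) (hc : 0 < c)
    (hf : ∀ u ∈ Set.Icc α β, ∀ v ∈ Set.Icc α β, ∀ t ∈ Set.Icc (0:ℝ) 1,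
      f (t * u + (1 - t) * v) ≤ t * f u + (1 - t) * f v - c * t * (1 - t) * (u - v) ^ 2) :
    ∑ i, b i * f (y i) ≤
      ∑ j, a j * f (x j) - c * ((∑ j, a j * x j ^ 2) - ∑ i, b i * y i ^ 2) := by
  have h := (convexOn_sub_const_mul_sq (convex_Icc α β) hf).sherman hx hb hA hArow
  simp only [← haA, ← hyA, mul_sub, Finset.sum_sub_distrib, mul_left_comm _ c,
    ← Finset.mul_sum] at h
  linarith
end

section
/- Let α < β, x₁,…,x_l ∈ [α,β], and a₁,…,a_l ≥ 0 with Σ_{j=1}^l a_j = 1; set x̄ = Σ_{j=1}^l a_j x_j. If f : [α,β] → ℝ is strongly convex with modulus c > 0, then f(x̄) ≤ Σ_{j=1}^l a_j f(x_j) − c Σ_{j=1}^l a_j (x_j − x̄)² ≤ Σ_{j=1}^l a_j f(x_j). (Jensen's inequality for strongly convex functions.) -/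
/-- The weighted variance equals the second moment minus the squared mean. -/
theorem weighted_variance_eq {ι : Type*} [Fintype ι] (a x : ι → ℝ) (hsum : ∑ j, a j = 1) :
    ∑ j, a j * (x j - ∑ k, a k * x k) ^ 2 = ∑ j, a j * x j ^ 2 - (∑ j, a j * x j) ^ 2 := by
  set m := ∑ k, a k * x k with hm
  have h : ∀ j, a j * (x j - m) ^ 2 = a j * x j ^ 2 - 2 * m * (a j * x j) + m ^ 2 * a j :=
    fun j => by ring
  simp only [h, Finset.sum_add_distrib, Finset.sum_sub_distrib, ← Finset.mul_sum, hsum, ← hm]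
  ring

/-- Jensen's inequality for strongly convex functions. -/
theorem jensen_strongly_convex
    (α β : ℝ) (hαβ : α < β) (l : ℕ)
    (x : Fin l → ℝ) (hx : ∀ j, x j ∈ Set.Icc α β)
    (a : Fin l → ℝ) (ha : ∀ j, 0 ≤ a j) (hsum : ∑ j, a j = 1)
    (f : ℝ → ℝ) (c : ℝ) (hc : 0 < c)
    (hf : ∀ u ∈ Set.Icc α β, ∀ v ∈ Set.Icc α β, ∀ t ∈ Set.Icc (0:ℝ) 1,
      f (t * u + (1 - t) * v) ≤ t * f u + (1 - t) * f v - c * t * (1 - t) * (u - v) ^ 2) :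
    f (∑ j, a j * x j) ≤
        (∑ j, a j * f (x j)) - c * ∑ j, a j * (x j - ∑ k, a k * x k) ^ 2 ∧
      (∑ j, a j * f (x j)) - c * (∑ j, a j * (x j - ∑ k, a k * x k) ^ 2) ≤
        ∑ j, a j * f (x j) := by
  have hg : ConvexOn ℝ (Set.Icc α β) fun y => f y - c * y ^ 2 := by
    refine ⟨convex_Icc α β, fun u hu v hv s t hs ht hst => ?_⟩
    obtain rfl : t = 1 - s := by linarith
    have h := hf u hu v hv s ⟨hs, by linarith⟩
    simp only [smul_eq_mul]
    linear_combination h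
  have hjensen := hg.map_sum_le (t := Finset.univ) (fun j _ => ha j) hsum (fun j _ => hx j)
  simp only [smul_eq_mul, mul_sub, Finset.sum_sub_distrib, mul_left_comm _ c,
    ← Finset.mul_sum] at hjensen
  constructor
  · rw [weighted_variance_eq a x hsum]
    linarith
  · exact sub_le_self _ (mul_nonneg hc.le
      (Finset.sum_nonneg fun j _ => mul_nonneg (ha j) (sq_nonneg _)))
end

section
/- Let α < β and let x = (x₁,…,x_m), y = (y₁,…,y_m) ∈ [α,β]^m be such that y is majorized by x (that is, the partial sums of the decreasing rearrangement of y are bounded by those of x, with equality for the total sums). Then for every f : [α,β] → ℝ strongly convex with modulus c > 0, Σ_{i=1}^m f(y_i) ≤ Σ_{i=1}^m f(x_i) − c (Σ_{i=1}^m x_i² − Σ_{i=1}^m y_i²) ≤ Σ_{i=1}^m f(x_i). (Majorization inequality for strongly convex functions.) -/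
/-- The slope of a convex function is monotone in both endpoints jointly. -/
theorem ConvexOn.slope_le_slope {s : Set ℝ} {g : ℝ → ℝ} (hg : ConvexOn ℝ s g)
    {a b a' b' : ℝ} (ha : a ∈ s) (hb : b ∈ s) (ha' : a' ∈ s) (hb' : b' ∈ s)
    (hab : a ≠ b) (hab' : a' ≠ b') (haa : a ≤ a') (hbb : b ≤ b') :
    slope g a b ≤ slope g a' b' := by
  have key : ∀ p ∈ s, ∀ q ∈ s, ∀ r ∈ s, q ≠ p → r ≠ p → q ≤ r → slope g p q ≤ slope g p r :=
    fun p hp q hq r hr hqp hrp hqr => hg.slope_mono hp ⟨hq, hqp⟩ ⟨hr, hrp⟩ hqr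
  by_cases h : b' = a
  · have hne : b ≠ a' := (lt_of_lt_of_le (lt_of_le_of_ne (h ▸ hbb) hab.symm) haa).ne
    calc slope g a b = slope g b a := slope_comm ..
      _ ≤ slope g b a' := key b hb a ha a' ha' hab hne.symm haa
      _ = slope g a' b := slope_comm ..
      _ ≤ slope g a' b' := key a' ha' b hb b' hb' hne hab'.symm hbb
  · calc slope g a b ≤ slope g a b' := key a ha b hb b' hb' hab.symm h hbb
      _ = slope g b' a := slope_comm ..
      _ ≤ slope g b' a' := key b' hb' a ha a' ha' (Ne.symm h) hab' haa
      _ = slope g a' b' := slope_comm ..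

theorem Fin.sum_filter_lt_succ {m : ℕ} (w : Fin m → ℝ) {k : ℕ} (hk : k < m) :
    ∑ i ∈ Finset.univ.filter (fun i : Fin m => (i : ℕ) < k + 1), w i =
      ∑ i ∈ Finset.univ.filter (fun i : Fin m => (i : ℕ) < k), w i + w ⟨k, hk⟩ := by
  have h : Finset.univ.filter (fun i : Fin m => (i : ℕ) < k + 1) =
      insert ⟨k, hk⟩ (Finset.univ.filter (fun i : Fin m => (i : ℕ) < k)) := by
    ext i
    simp only [Finset.mem_filter, Finset.mem_univ, true_and, Finset.mem_insert, Fin.ext_iff]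
    omega
  rw [h, Finset.sum_insert (by simp), add_comm]

/-- Karamata's inequality for antitone families. -/
theorem ConvexOn.sum_le_sum_of_antitone {s : Set ℝ} {g : ℝ → ℝ} (hg : ConvexOn ℝ s g) {m : ℕ}
    {a b : Fin m → ℝ} (ha : ∀ i, a i ∈ s) (hb : ∀ i, b i ∈ s) (ha_anti : Antitone a)
    (hb_anti : Antitone b)
    (hmaj : ∀ k : ℕ, k ≤ m →
      ∑ i ∈ Finset.univ.filter (fun i : Fin m => (i : ℕ) < k), b i ≤
        ∑ i ∈ Finset.univ.filter (fun i : Fin m => (i : ℕ) < k), a i)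
    (hsum : ∑ i, b i = ∑ i, a i) :
    ∑ i, g (b i) ≤ ∑ i, g (a i) := by
  have key : ∀ k ≤ m, ∀ M : ℝ,
      (∀ i : Fin m, (i : ℕ) < k → a i ≠ b i → M ≤ slope g (a i) (b i)) →
      M * ∑ i ∈ Finset.univ.filter (fun i : Fin m => (i : ℕ) < k), (a i - b i) ≤
        ∑ i ∈ Finset.univ.filter (fun i : Fin m => (i : ℕ) < k), (g (a i) - g (b i)) := by
    intro k
    induction k with
    | zero => simp
    | succ k ih =>
      intro hk M hM
      have hnonneg := sub_nonneg.2 (hmaj (k + 1) hk)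
      rw [← Finset.sum_sub_distrib] at hnonneg
      rw [Fin.sum_filter_lt_succ _ hk] at hnonneg ⊢
      rw [Fin.sum_filter_lt_succ _ hk]
      by_cases hne : a ⟨k, hk⟩ = b ⟨k, hk⟩
      · simpa [hne] using ih (Nat.le_of_lt hk) M fun i hi => hM i (by omega)
      · have hstep := ih (Nat.le_of_lt hk) (slope g (a ⟨k, hk⟩) (b ⟨k, hk⟩)) fun i hi hi' =>
          hg.slope_le_slope (ha _) (hb _) (ha _) (hb _) hne hi'
            (ha_anti (Fin.mk_le_mk.2 hi.le)) (hb_anti (Fin.mk_le_mk.2 hi.le))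
        have hlast : slope g (a ⟨k, hk⟩) (b ⟨k, hk⟩) * (a ⟨k, hk⟩ - b ⟨k, hk⟩) =
            g (a ⟨k, hk⟩) - g (b ⟨k, hk⟩) := by
          rw [slope_comm, slope_def_field, div_mul_cancel₀ _ (sub_ne_zero.2 hne)]
        have hle := mul_le_mul_of_nonneg_right (hM ⟨k, hk⟩ (Nat.lt_succ_self k) hne) hnonneg
        linarith
  obtain ⟨M, hM⟩ := (Set.finite_range fun i => slope g (a i) (b i)).bddBelow
  have h := key m le_rfl M fun i _ _ => hM ⟨i, rfl⟩
  simp only [Fin.is_lt, Finset.filter_true, Finset.sum_sub_distrib, hsum] at h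
  linarith


/-- Majorization inequality for strongly convex functions. -/
theorem majorization_strongly_convex
    (α β : ℝ) (hαβ : α < β) (m : ℕ)
    (x y : Fin m → ℝ) (hx : ∀ i, x i ∈ Set.Icc α β) (hy : ∀ i, y i ∈ Set.Icc α β)
    (σ τ : Equiv.Perm (Fin m))
    (hxσ : Antitone (x ∘ σ)) (hyτ : Antitone (y ∘ τ))
    (hmaj : ∀ k : ℕ, k ≤ m →
      ∑ i ∈ Finset.univ.filter (fun i : Fin m => (i : ℕ) < k), y (τ i) ≤
        ∑ i ∈ Finset.univ.filter (fun i : Fin m => (i : ℕ) < k), x (σ i))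
    (hsum : ∑ i, y i = ∑ i, x i)
    (f : ℝ → ℝ) (c : ℝ) (hc : 0 < c)
    (hf : ∀ u ∈ Set.Icc α β, ∀ v ∈ Set.Icc α β, ∀ t ∈ Set.Icc (0:ℝ) 1,
      f (t * u + (1 - t) * v) ≤ t * f u + (1 - t) * f v - c * t * (1 - t) * (u - v) ^ 2) :
    (∑ i, f (y i) ≤ (∑ i, f (x i)) - c * ((∑ i, x i ^ 2) - ∑ i, y i ^ 2)) ∧
      (∑ i, f (x i)) - c * ((∑ i, x i ^ 2) - ∑ i, y i ^ 2) ≤ ∑ i, f (x i) := by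
  have karamata : ∀ g : ℝ → ℝ, ConvexOn ℝ (Set.Icc α β) g → ∑ i, g (y i) ≤ ∑ i, g (x i) := by
    intro g hg
    rw [← Equiv.sum_comp τ fun i => g (y i), ← Equiv.sum_comp σ fun i => g (x i)]
    exact hg.sum_le_sum_of_antitone (a := x ∘ σ) (b := y ∘ τ) (fun i => hx _) (fun i => hy _)
      hxσ hyτ hmaj (by simpa [Equiv.sum_comp τ y, Equiv.sum_comp σ x] using hsum)
  have hconv : ConvexOn ℝ (Set.Icc α β) fun u => f u - c * u ^ 2 := by
    refine ⟨convex_Icc α β, fun u hu v hv p q hp hq hpq => ?_⟩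
    obtain rfl : q = 1 - p := by linarith
    have h := hf u hu v hv p ⟨hp, by linarith⟩
    simp only [smul_eq_mul]
    linear_combination h
  have hsq : ConvexOn ℝ (Set.Icc α β) fun u : ℝ => u ^ 2 :=
    (even_two.convexOn_pow).subset (Set.subset_univ _) (convex_Icc α β)
  have h₁ := karamata _ hconv
  have h₂ := karamata _ hsq
  simp only [Finset.sum_sub_distrib, ← Finset.mul_sum] at h₁
  refine ⟨by linarith, sub_le_self _ (mul_nonneg hc.le (sub_nonneg.2 h₂))⟩
end

section
/- Let α < β, let x = (x₁,…,x_m), y = (y₁,…,y_m) ∈ [α,β]^m and a = (a₁,…,a_m) ∈ [0,∞)^m, and suppose there exists a doubly stochastic matrix A = (a_{ij}) ∈ M_{m×m}(ℝ) with a = aA and y_i = Σ_{j=1}^m a_{ij} x_j for each i. Then for every f : [α,β] → ℝ strongly convex with modulus c > 0, Σ_{i=1}^m a_i f(y_i) ≤ Σ_{i=1}^m a_i f(x_i) − c (Σ_{i=1}^m a_i x_i² − Σ_{i=1}^m a_i y_i²) ≤ Σ_{i=1}^m a_i f(x_i). (Fuchs' inequality for strongly convex functions.) -/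
/-- **Fuchs' inequality** for convex functions, with weights satisfying `a = aA` for a row-stochastic
matrix `A`. -/
theorem ConvexOn.sum_mul_le_sum_mul_of_stochastic {ι : Type*} [Fintype ι] {s : Set ℝ} {g : ℝ → ℝ}
    (hg : ConvexOn ℝ s g) {x y a : ι → ℝ} (hx : ∀ i, x i ∈ s) (ha : ∀ i, 0 ≤ a i)
    {A : ι → ι → ℝ} (hA : ∀ i j, 0 ≤ A i j) (hArow : ∀ i, ∑ j, A i j = 1)
    (haA : ∀ j, a j = ∑ i, a i * A i j) (hyA : ∀ i, y i = ∑ j, A i j * x j) :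
    ∑ i, a i * g (y i) ≤ ∑ i, a i * g (x i) := by
  have jensen (i : ι) : g (y i) ≤ ∑ j, A i j * g (x j) := by
    rw [hyA i]
    exact hg.map_sum_le (fun j _ ↦ hA i j) (hArow i) (fun j _ ↦ hx j)
  calc ∑ i, a i * g (y i) ≤ ∑ i, a i * ∑ j, A i j * g (x j) :=
        Finset.sum_le_sum fun i _ ↦ mul_le_mul_of_nonneg_left (jensen i) (ha i)
    _ = ∑ j, (∑ i, a i * A i j) * g (x j) := by
        simp only [Finset.mul_sum, Finset.sum_mul, mul_assoc]
        exact Finset.sum_comm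
    _ = ∑ i, a i * g (x i) := by simp only [← haA]


/-- Fuchs' inequality for strongly convex functions. -/
theorem fuchs_strongly_convex
    (α β : ℝ) (hαβ : α < β) (m : ℕ)
    (x y : Fin m → ℝ) (hx : ∀ i, x i ∈ Set.Icc α β) (hy : ∀ i, y i ∈ Set.Icc α β)
    (a : Fin m → ℝ) (ha : ∀ i, 0 ≤ a i)
    (A : Fin m → Fin m → ℝ) (hA : ∀ i j, 0 ≤ A i j)
    (hArow : ∀ i, ∑ j, A i j = 1) (hAcol : ∀ j, ∑ i, A i j = 1)
    (haA : ∀ j, a j = ∑ i, a i * A i j) (hyA : ∀ i, y i = ∑ j, A i j * x j)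
    (f : ℝ → ℝ) (c : ℝ) (hc : 0 < c)
    (hf : ∀ u ∈ Set.Icc α β, ∀ v ∈ Set.Icc α β, ∀ t ∈ Set.Icc (0:ℝ) 1,
      f (t * u + (1 - t) * v) ≤ t * f u + (1 - t) * f v - c * t * (1 - t) * (u - v) ^ 2) :
    (∑ i, a i * f (y i) ≤
        (∑ i, a i * f (x i)) - c * ((∑ i, a i * x i ^ 2) - ∑ i, a i * y i ^ 2)) ∧
      (∑ i, a i * f (x i)) - c * ((∑ i, a i * x i ^ 2) - ∑ i, a i * y i ^ 2) ≤
        ∑ i, a i * f (x i) := by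
  have hconv : ConvexOn ℝ (Set.Icc α β) fun u ↦ f u - c * u ^ 2 := by
    refine ⟨convex_Icc α β, fun u hu v hv t s ht hs hts ↦ ?_⟩
    obtain rfl : s = 1 - t := by linarith
    have h := hf u hu v hv t ⟨ht, by linarith⟩
    simp only [smul_eq_mul]
    linear_combination h
  have hsq : ConvexOn ℝ (Set.Icc α β) fun u : ℝ ↦ u ^ 2 :=
    even_two.convexOn_pow.subset (Set.subset_univ _) (convex_Icc α β)
  have h₁ := hconv.sum_mul_le_sum_mul_of_stochastic hx ha hA hArow haA hyA
  have h₂ := hsq.sum_mul_le_sum_mul_of_stochastic hx ha hA hArow haA hyA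
  simp only [mul_sub, mul_left_comm _ c, Finset.sum_sub_distrib, ← Finset.mul_sum] at h₁
  constructor
  · linarith
  · exact sub_le_self _ (mul_nonneg hc.le (sub_nonneg.2 h₂))
end

section
/- Let α < β, x = (x₁,…,x_l) ∈ [α,β]^l, y = (y₁,…,y_m) ∈ [α,β]^m, a ∈ [0,∞)^l and b ∈ [0,∞)^m be such that (y,b) ≺ (x,a) in the weighted majorization sense, and set B_m = Σ_{i=1}^m b_i. If f : [α,β] → ℝ is strongly convex with modulus c > 0, then Σ_{j=1}^l a_j f(x_j) ≤ ((B_m β − Σ_{j=1}^l a_j x_j)/(β − α)) f(α) + ((Σ_{j=1}^l a_j x_j − B_m α)/(β − α)) f(β) − c Σ_{j=1}^l a_j (β − x_j)(x_j − α). (Converse Sherman inequality for strongly convex functions.) -/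
/-- A strongly convex function on `[α, β]` lies below its chord by at least
`c * (β - z) * (z - α)`. -/
lemma strongly_convex_le_chord {α β : ℝ} (hαβ : α < β) {f : ℝ → ℝ} {c : ℝ}
    (hf : ∀ u ∈ Set.Icc α β, ∀ v ∈ Set.Icc α β, ∀ t ∈ Set.Icc (0:ℝ) 1,
      f (t * u + (1 - t) * v) ≤ t * f u + (1 - t) * f v - c * t * (1 - t) * (u - v) ^ 2)
    {z : ℝ} (hz : z ∈ Set.Icc α β) :
    f z ≤ (β - z) / (β - α) * f α + (z - α) / (β - α) * f β - c * ((β - z) * (z - α)) := by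
  have hpos : 0 < β - α := sub_pos.2 hαβ
  have hne : β - α ≠ 0 := hpos.ne'
  have h := hf α (Set.left_mem_Icc.2 hαβ.le) β (Set.right_mem_Icc.2 hαβ.le)
    ((β - z) / (β - α))
    ⟨div_nonneg (sub_nonneg.2 hz.2) hpos.le, (div_le_one hpos).2 (by linarith [hz.1])⟩
  have h1 : 1 - (β - z) / (β - α) = (z - α) / (β - α) := by field_simp; ring
  have h2 : (β - z) / (β - α) * α + (z - α) / (β - α) * β = z := by field_simp; ring
  have h3 : c * ((β - z) / (β - α)) * ((z - α) / (β - α)) * (α - β) ^ 2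
      = c * ((β - z) * (z - α)) := by field_simp; ring
  rwa [h1, h2, h3] at h

/-- Converse Sherman inequality for strongly convex functions. -/
theorem converse_sherman_strongly_convex
    (α β : ℝ) (hαβ : α < β) (l m : ℕ)
    (x : Fin l → ℝ) (hx : ∀ j, x j ∈ Set.Icc α β)
    (y : Fin m → ℝ) (hy : ∀ i, y i ∈ Set.Icc α β)
    (a : Fin l → ℝ) (ha : ∀ j, 0 ≤ a j)
    (b : Fin m → ℝ) (hb : ∀ i, 0 ≤ b i)
    (A : Fin m → Fin l → ℝ) (hA : ∀ i j, 0 ≤ A i j) (hArow : ∀ i, ∑ j, A i j = 1)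
    (haA : ∀ j, a j = ∑ i, b i * A i j) (hyA : ∀ i, y i = ∑ j, A i j * x j)
    (f : ℝ → ℝ) (c : ℝ) (hc : 0 < c)
    (hf : ∀ u ∈ Set.Icc α β, ∀ v ∈ Set.Icc α β, ∀ t ∈ Set.Icc (0:ℝ) 1,
      f (t * u + (1 - t) * v) ≤ t * f u + (1 - t) * f v - c * t * (1 - t) * (u - v) ^ 2) :
    ∑ j, a j * f (x j) ≤
      (((∑ i, b i) * β - ∑ j, a j * x j) / (β - α)) * f α
        + (((∑ j, a j * x j) - (∑ i, b i) * α) / (β - α)) * f β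
        - c * ∑ j, a j * (β - x j) * (x j - α) := by
  have hab : ∑ i, b i = ∑ j, a j := by
    simp_rw [haA]
    rw [Finset.sum_comm]
    simp_rw [← Finset.mul_sum, hArow, mul_one]
  calc ∑ j, a j * f (x j)
      ≤ ∑ j, a j * ((β - x j) / (β - α) * f α + (x j - α) / (β - α) * f β
          - c * ((β - x j) * (x j - α))) :=
        Finset.sum_le_sum fun j _ =>
          mul_le_mul_of_nonneg_left (strongly_convex_le_chord hαβ hf (hx j)) (ha j)
    _ = _ := by
        rw [hab, Finset.sum_mul, Finset.sum_mul, ← Finset.sum_sub_distrib,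
          ← Finset.sum_sub_distrib, Finset.sum_div, Finset.sum_div, Finset.sum_mul,
          Finset.sum_mul, Finset.mul_sum, ← Finset.sum_add_distrib, ← Finset.sum_sub_distrib]
        exact Finset.sum_congr rfl fun j _ => by ring
end

section
/- Let α < β and let x = (x₁,…,x_m), y = (y₁,…,y_m) ∈ [α,β]^m be such that y is majorized by x. Then for every f : [α,β] → ℝ strongly convex with modulus c > 0, Σ_{i=1}^m f(y_i) ≤ Σ_{i=1}^m f(x_i) − c (Σ_{i=1}^m x_i² − Σ_{i=1}^m y_i²) ≤ Σ_{i=1}^m f(x_i) ≤ ((mβ − Σ_{j=1}^m x_j)/(β − α)) f(α) + ((Σ_{j=1}^m x_j − mα)/(β − α)) f(β) − c Σ_{j=1}^m (β − x_j)(x_j − α). (Majorization inequality and its conversion for strongly convex functions.) -/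
/-- The secant slopes of a convex function are monotone in both endpoints. -/
theorem ConvexOn.slope_le_slope_of_le {s : Set ℝ} {g : ℝ → ℝ} (hg : ConvexOn ℝ s g)
    {a b a' b' : ℝ} (ha : a ∈ s) (hb : b ∈ s) (ha' : a' ∈ s) (hb' : b' ∈ s)
    (hab : a ≠ b) (hab' : a' ≠ b') (haa : a ≤ a') (hbb : b ≤ b') :
    (g a - g b) / (a - b) ≤ (g a' - g b') / (a' - b') := by
  have secant_symm (u v : ℝ) : (g u - g v) / (u - v) = (g v - g u) / (v - u) := by
    rw [← neg_sub (g v), ← neg_sub v, neg_div_neg_eq]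
  by_cases h : a' = b
  · have h' : a ≠ b' := by
      rintro rfl
      exact hab (le_antisymm (haa.trans h.le) hbb)
    calc (g a - g b) / (a - b) = (g b - g a) / (b - a) := secant_symm _ _
      _ ≤ (g b' - g a) / (b' - a) := hg.secant_mono ha hb hb' hab.symm h'.symm hbb
      _ = (g a - g b') / (a - b') := secant_symm _ _
      _ ≤ (g a' - g b') / (a' - b') := hg.secant_mono hb' ha ha' h' hab' haa
  · calc (g a - g b) / (a - b) ≤ (g a' - g b) / (a' - b) := hg.secant_mono hb ha ha' hab h haa
      _ = (g b - g a') / (b - a') := secant_symm _ _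
      _ ≤ (g b' - g a') / (b' - a') :=
        hg.secant_mono ha' hb hb' (Ne.symm h) hab'.symm hbb
      _ = (g a' - g b') / (a' - b') := secant_symm _ _

/-- Abel's inequality: if `d` has nonnegative partial sums and `s` is antitone on the support
of `d`, then a lower bound of `s` can be pulled out of the partial sums of `s * d`. -/
theorem mul_sum_filter_lt_le_sum_mul {m : ℕ} {s d : Fin m → ℝ}
    (hs : ∀ i j, i ≤ j → d i ≠ 0 → d j ≠ 0 → s j ≤ s i)
    (hd : ∀ k : ℕ, k ≤ m → 0 ≤ ∑ i ∈ Finset.univ.filter (fun i : Fin m => (i : ℕ) < k), d i)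
    (k : ℕ) (hk : k ≤ m) (M : ℝ) (hM : ∀ i : Fin m, (i : ℕ) < k → d i ≠ 0 → M ≤ s i) :
    M * ∑ i ∈ Finset.univ.filter (fun i : Fin m => (i : ℕ) < k), d i ≤
      ∑ i ∈ Finset.univ.filter (fun i : Fin m => (i : ℕ) < k), s i * d i := by
  induction k generalizing M with
  | zero => simp
  | succ k ih =>
    have hpos := hd (k + 1) hk
    have hins : Finset.univ.filter (fun i : Fin m => (i : ℕ) < k + 1) =
        insert ⟨k, hk⟩ (Finset.univ.filter (fun i : Fin m => (i : ℕ) < k)) := by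
      ext i
      simp only [Finset.mem_filter, Finset.mem_univ, true_and, Finset.mem_insert, Fin.ext_iff]
      omega
    rw [hins, Finset.sum_insert (by simp)] at hpos ⊢
    rw [Finset.sum_insert (by simp)]
    by_cases h0 : d ⟨k, hk⟩ = 0
    · simpa [h0] using ih (by omega) M fun i hi => hM i (by omega)
    · have hstep := ih (by omega) (s ⟨k, hk⟩) fun i hi hdi =>
        hs i ⟨k, hk⟩ (Fin.le_def.2 hi.le) hdi h0
      have hMk := mul_le_mul_of_nonneg_right (hM ⟨k, hk⟩ (Nat.lt_succ_self k) h0) hpos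
      linarith

/-- Karamata's inequality for decreasing sequences. -/
theorem ConvexOn.sum_le_sum_of_antitone_of_partial_sums_le {S : Set ℝ} {g : ℝ → ℝ}
    (hg : ConvexOn ℝ S g) {m : ℕ} {a b : Fin m → ℝ} (ha : ∀ i, a i ∈ S) (hb : ∀ i, b i ∈ S)
    (ha_anti : Antitone a) (hb_anti : Antitone b)
    (hmaj : ∀ k : ℕ, k ≤ m →
      ∑ i ∈ Finset.univ.filter (fun i : Fin m => (i : ℕ) < k), b i ≤
        ∑ i ∈ Finset.univ.filter (fun i : Fin m => (i : ℕ) < k), a i)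
    (hsum : ∑ i, b i = ∑ i, a i) :
    ∑ i, g (b i) ≤ ∑ i, g (a i) := by
  set s : Fin m → ℝ := fun i => (g (a i) - g (b i)) / (a i - b i)
  obtain ⟨M, hM⟩ := (Set.finite_range s).bddBelow
  have key := mul_sum_filter_lt_le_sum_mul (s := s) (d := fun i => a i - b i)
    (fun i j hij hi hj => hg.slope_le_slope_of_le (ha j) (hb j) (ha i) (hb i)
      (sub_ne_zero.1 hj) (sub_ne_zero.1 hi) (ha_anti hij) (hb_anti hij))
    (fun k hk => by rw [Finset.sum_sub_distrib]; exact sub_nonneg.2 (hmaj k hk))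
    m le_rfl M (fun i _ _ => hM (Set.mem_range_self i))
  have hmul (i : Fin m) : s i * (a i - b i) = g (a i) - g (b i) := by
    rcases eq_or_ne (a i) (b i) with h | h
    · simp [h]
    · exact div_mul_cancel₀ _ (sub_ne_zero.2 h)
  simpa [hmul, hsum] using key

/-- Karamata's inequality, with the decreasing rearrangements given by permutations. -/
theorem ConvexOn.sum_le_sum_of_majorized {S : Set ℝ} {g : ℝ → ℝ}
    (hg : ConvexOn ℝ S g) {m : ℕ} {x y : Fin m → ℝ} (hx : ∀ i, x i ∈ S) (hy : ∀ i, y i ∈ S)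
    (σ τ : Equiv.Perm (Fin m)) (hxσ : Antitone (x ∘ σ)) (hyτ : Antitone (y ∘ τ))
    (hmaj : ∀ k : ℕ, k ≤ m →
      ∑ i ∈ Finset.univ.filter (fun i : Fin m => (i : ℕ) < k), y (τ i) ≤
        ∑ i ∈ Finset.univ.filter (fun i : Fin m => (i : ℕ) < k), x (σ i))
    (hsum : ∑ i, y i = ∑ i, x i) :
    ∑ i, g (y i) ≤ ∑ i, g (x i) := by
  rw [← Equiv.sum_comp σ fun i => g (x i), ← Equiv.sum_comp τ fun i => g (y i)]
  refine hg.sum_le_sum_of_antitone_of_partial_sums_le (a := x ∘ σ) (b := y ∘ τ)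
    (fun i => hx _) (fun i => hy _) hxσ hyτ hmaj ?_
  simp only [Function.comp_apply]
  rw [Equiv.sum_comp σ x, Equiv.sum_comp τ y, hsum]

/-- Majorization inequality and its conversion for strongly convex functions. -/
theorem majorization_and_converse_strongly_convex
    (α β : ℝ) (hαβ : α < β) (m : ℕ)
    (x y : Fin m → ℝ) (hx : ∀ i, x i ∈ Set.Icc α β) (hy : ∀ i, y i ∈ Set.Icc α β)
    (σ τ : Equiv.Perm (Fin m))
    (hxσ : Antitone (x ∘ σ)) (hyτ : Antitone (y ∘ τ))
    (hmaj : ∀ k : ℕ, k ≤ m →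
      ∑ i ∈ Finset.univ.filter (fun i : Fin m => (i : ℕ) < k), y (τ i) ≤
        ∑ i ∈ Finset.univ.filter (fun i : Fin m => (i : ℕ) < k), x (σ i))
    (hsum : ∑ i, y i = ∑ i, x i)
    (f : ℝ → ℝ) (c : ℝ) (hc : 0 < c)
    (hf : ∀ u ∈ Set.Icc α β, ∀ v ∈ Set.Icc α β, ∀ t ∈ Set.Icc (0:ℝ) 1,
      f (t * u + (1 - t) * v) ≤ t * f u + (1 - t) * f v - c * t * (1 - t) * (u - v) ^ 2) :
    (∑ i, f (y i) ≤ (∑ i, f (x i)) - c * ((∑ i, x i ^ 2) - ∑ i, y i ^ 2)) ∧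
      ((∑ i, f (x i)) - c * ((∑ i, x i ^ 2) - ∑ i, y i ^ 2) ≤ ∑ i, f (x i)) ∧
      (∑ i, f (x i) ≤
        (((m : ℝ) * β - ∑ j, x j) / (β - α)) * f α
          + (((∑ j, x j) - (m : ℝ) * α) / (β - α)) * f β
          - c * ∑ j, (β - x j) * (x j - α)) := by
  have hconv : ConvexOn ℝ (Set.Icc α β) fun u => f u - c * u ^ 2 := by
    refine ⟨convex_Icc α β, fun u hu v hv p q hp hq hpq => ?_⟩
    obtain rfl : q = 1 - p := by linarith
    have h := hf u hu v hv p ⟨hp, by linarith⟩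
    simp only [smul_eq_mul]
    linear_combination h
  have hfg := hconv.sum_le_sum_of_majorized hx hy σ τ hxσ hyτ hmaj hsum
  have hsq := (even_two.convexOn_pow (𝕜 := ℝ)).sum_le_sum_of_majorized
    (fun i => Set.mem_univ (x i)) (fun i => Set.mem_univ (y i)) σ τ hxσ hyτ hmaj hsum
  refine ⟨?_, ?_, ?_⟩
  · simp only [Finset.sum_sub_distrib, ← Finset.mul_sum] at hfg
    linarith
  · exact sub_le_self _ (mul_nonneg hc.le (sub_nonneg.2 hsq))
  · have hpos : 0 < β - α := sub_pos.2 hαβ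
    have hpoint (j : Fin m) : f (x j) ≤ (β - x j) / (β - α) * f α
        + (x j - α) / (β - α) * f β - c * ((β - x j) * (x j - α)) := by
      obtain ⟨hαx, hxβ⟩ := hx j
      have h := hf α ⟨le_rfl, hαβ.le⟩ β ⟨hαβ.le, le_rfl⟩ ((β - x j) / (β - α))
        ⟨div_nonneg (by linarith) hpos.le, (div_le_one hpos).2 (by linarith)⟩
      have h1 : 1 - (β - x j) / (β - α) = (x j - α) / (β - α) := by
        field_simp
        ring
      rw [h1] at h
      convert h using 2
      · field_simp
        ring
      · field_simp
        ring
    refine (Finset.sum_le_sum fun j _ => hpoint j).trans_eq ?_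
    simp only [Finset.sum_sub_distrib, Finset.sum_add_distrib, ← Finset.sum_mul,
      ← Finset.mul_sum, ← Finset.sum_div, Finset.sum_const, Finset.card_univ, Fintype.card_fin,
      nsmul_eq_mul]
end

section
/- Let α < β, let x, y ∈ [α,β]^m and a ∈ [0,∞)^m, and suppose there exists a doubly stochastic matrix A ∈ M_{m×m}(ℝ) with a = aA and y_i = Σ_{j=1}^m a_{ij} x_j for each i. Set A_m = Σ_{i=1}^m a_i. If f : [α,β] → ℝ is strongly convex with modulus c > 0, then Σ_{i=1}^m a_i f(y_i) ≤ Σ_{i=1}^m a_i f(x_i) − c (Σ_{i=1}^m a_i x_i² − Σ_{i=1}^m a_i y_i²) ≤ Σ_{i=1}^m a_i f(x_i) ≤ ((A_m β − Σ_{i=1}^m a_i x_i)/(β − α)) f(α) + ((Σ_{i=1}^m a_i x_i − A_m α)/(β − α)) f(β) − c Σ_{i=1}^m a_i (β − x_i)(x_i − α). (Fuchs' inequality and its conversion for strongly convex functions.) -/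
/-- Fuchs' inequality and its conversion for strongly convex functions. -/
theorem fuchs_and_converse_strongly_convex
    (α β : ℝ) (hαβ : α < β) (m : ℕ)
    (x y : Fin m → ℝ) (hx : ∀ i, x i ∈ Set.Icc α β) (hy : ∀ i, y i ∈ Set.Icc α β)
    (a : Fin m → ℝ) (ha : ∀ i, 0 ≤ a i)
    (A : Fin m → Fin m → ℝ) (hA : ∀ i j, 0 ≤ A i j)
    (hArow : ∀ i, ∑ j, A i j = 1) (hAcol : ∀ j, ∑ i, A i j = 1)
    (haA : ∀ j, a j = ∑ i, a i * A i j) (hyA : ∀ i, y i = ∑ j, A i j * x j)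
    (f : ℝ → ℝ) (c : ℝ) (hc : 0 < c)
    (hf : ∀ u ∈ Set.Icc α β, ∀ v ∈ Set.Icc α β, ∀ t ∈ Set.Icc (0:ℝ) 1,
      f (t * u + (1 - t) * v) ≤ t * f u + (1 - t) * f v - c * t * (1 - t) * (u - v) ^ 2) :
    (∑ i, a i * f (y i) ≤
        (∑ i, a i * f (x i)) - c * ((∑ i, a i * x i ^ 2) - ∑ i, a i * y i ^ 2)) ∧
      ((∑ i, a i * f (x i)) - c * ((∑ i, a i * x i ^ 2) - ∑ i, a i * y i ^ 2) ≤
        ∑ i, a i * f (x i)) ∧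
      (∑ i, a i * f (x i) ≤
        (((∑ i, a i) * β - ∑ i, a i * x i) / (β - α)) * f α
          + (((∑ i, a i * x i) - (∑ i, a i) * α) / (β - α)) * f β
          - c * ∑ i, a i * (β - x i) * (x i - α)) := by
  have hg : ConvexOn ℝ (Set.Icc α β) (fun u => f u - c * u ^ 2) := by
    refine ⟨convex_Icc α β, fun u hu v hv p q hp hq hpq => ?_⟩
    obtain rfl : q = 1 - p := by linarith
    have h := hf u hu v hv p ⟨hp, by linarith⟩
    simp only [smul_eq_mul]
    linear_combination h
  have hsq : ConvexOn ℝ (Set.Icc α β) (fun u : ℝ => u ^ 2) :=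
    (even_two.convexOn_pow).subset (Set.subset_univ _) (convex_Icc α β)
  have hfuchs := hg.sum_mul_le_sum_mul_of_stochastic hx ha hA hArow haA hyA
  have hfuchs_sq := hsq.sum_mul_le_sum_mul_of_stochastic hx ha hA hArow haA hyA
  have hsplit (z : Fin m → ℝ) : ∑ i, a i * (f (z i) - c * z i ^ 2) =
      (∑ i, a i * f (z i)) - c * ∑ i, a i * z i ^ 2 := by
    rw [Finset.mul_sum, ← Finset.sum_sub_distrib]
    exact Finset.sum_congr rfl fun i _ => by ring
  refine ⟨?_, ?_, ?_⟩
  · simp only [hsplit] at hfuchs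
    linarith
  · have := mul_nonneg hc.le (sub_nonneg.2 hfuchs_sq)
    linarith
  · have hpos : 0 < β - α := sub_pos.2 hαβ
    have hchord (i : Fin m) : f (x i) ≤ (β - x i) / (β - α) * f α + (x i - α) / (β - α) * f β
        - c * ((β - x i) * (x i - α)) := by
      obtain ⟨hl, hr⟩ := hx i
      have h := hf α ⟨le_rfl, hαβ.le⟩ β ⟨hαβ.le, le_rfl⟩ ((β - x i) / (β - α))
        ⟨div_nonneg (by linarith) hpos.le, (div_le_one hpos).2 (by linarith)⟩
      have hcompl : 1 - (β - x i) / (β - α) = (x i - α) / (β - α) := by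
        field_simp
        ring
      have hpt : (β - x i) / (β - α) * α + (x i - α) / (β - α) * β = x i := by
        field_simp
        ring
      have hdefect : c * ((β - x i) / (β - α)) * ((x i - α) / (β - α)) * (α - β) ^ 2 =
          c * ((β - x i) * (x i - α)) := by
        field_simp
        ring
      rwa [hcompl, hpt, hdefect] at h
    refine (Finset.sum_le_sum fun i _ => mul_le_mul_of_nonneg_left (hchord i) (ha i)).trans_eq ?_
    simp only [Finset.sum_mul, ← Finset.sum_sub_distrib, Finset.sum_div, Finset.mul_sum,
      ← Finset.sum_add_distrib]
    exact Finset.sum_congr rfl fun i _ => by ring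
end

section
/- Let 0 < α < β, let p = (p₁,…,p_l), q = (q₁,…,q_l) be vectors with positive entries such that q_j/p_j ∈ [α,β] for all j, and let R = (r_{ij}) ∈ M_{m×l}(ℝ) be a column stochastic matrix (nonnegative entries, each column summing to 1) with ⟨p,r_i⟩ := Σ_{j=1}^l p_j r_{ij} > 0 and ⟨q,r_i⟩ := Σ_{j=1}^l q_j r_{ij}, and suppose ⟨q,r_i⟩/⟨p,r_i⟩ ∈ [α,β] for i = 1,…,m. Then for every f : [α,β] → ℝ strongly convex with modulus c > 0, Σ_{i=1}^m ⟨p,r_i⟩ f(⟨q,r_i⟩/⟨p,r_i⟩) ≤ Σ_{j=1}^l p_j f(q_j/p_j) − c (Σ_{j=1}^l p_j (q_j/p_j)² − Σ_{i=1}^m ⟨p,r_i⟩ (⟨q,r_i⟩/⟨p,r_i⟩)²) ≤ Σ_{j=1}^l p_j f(q_j/p_j). -/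
/-- Sherman's inequality for generalized divergences: aggregating along a column stochastic matrix
does not increase the divergence generated by a convex function. -/
theorem sum_mul_map_div_le_of_column_stochastic {ι κ : Type*} [Fintype ι] [Fintype κ]
    {s : Set ℝ} {g : ℝ → ℝ} (hg : ConvexOn ℝ s g) {p q : ι → ℝ} (hp : ∀ j, 0 < p j)
    (hqp : ∀ j, q j / p j ∈ s) {R : κ → ι → ℝ} (hR : ∀ i j, 0 ≤ R i j)
    (hRcol : ∀ j, ∑ i, R i j = 1) (hpr : ∀ i, 0 < ∑ j, p j * R i j) :
    ∑ i, (∑ j, p j * R i j) * g ((∑ j, q j * R i j) / (∑ j, p j * R i j)) ≤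
      ∑ j, p j * g (q j / p j) := by
  have row (i : κ) : (∑ j, p j * R i j) * g ((∑ j, q j * R i j) / (∑ j, p j * R i j)) ≤
      ∑ j, p j * R i j * g (q j / p j) := by
    have h := hg.map_centerMass_le (t := Finset.univ) (w := fun j => p j * R i j)
      (p := fun j => q j / p j) (fun j _ => mul_nonneg (hp j).le (hR i j)) (hpr i)
      (fun j _ => hqp j)
    have hq : ∑ j, p j * R i j * (q j / p j) = ∑ j, q j * R i j :=
      Finset.sum_congr rfl fun j _ => by
        have := (hp j).ne'
        field_simp
    simp only [Finset.centerMass, smul_eq_mul, Function.comp_apply, hq] at h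
    rw [← div_eq_inv_mul, ← div_eq_inv_mul, le_div_iff₀ (hpr i)] at h
    rwa [mul_comm]
  calc _ ≤ ∑ i, ∑ j, p j * R i j * g (q j / p j) := Finset.sum_le_sum fun i _ => row i
    _ = ∑ j, p j * g (q j / p j) := by
      rw [Finset.sum_comm]
      refine Finset.sum_congr rfl fun j _ => ?_
      rw [← Finset.sum_mul, ← Finset.mul_sum, hRcol, mul_one]

/-- Sherman-type bounds for the generalized f-divergence (lower part). -/
theorem f_divergence_sherman_strongly_convex
    (α β : ℝ) (hα : 0 < α) (hαβ : α < β) (l m : ℕ)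
    (p q : Fin l → ℝ) (hp : ∀ j, 0 < p j) (hq : ∀ j, 0 < q j)
    (hqp : ∀ j, q j / p j ∈ Set.Icc α β)
    (R : Fin m → Fin l → ℝ) (hR : ∀ i j, 0 ≤ R i j) (hRcol : ∀ j, ∑ i, R i j = 1)
    (hpr : ∀ i, 0 < ∑ j, p j * R i j)
    (hratio : ∀ i, (∑ j, q j * R i j) / (∑ j, p j * R i j) ∈ Set.Icc α β)
    (f : ℝ → ℝ) (c : ℝ) (hc : 0 < c)
    (hf : ∀ u ∈ Set.Icc α β, ∀ v ∈ Set.Icc α β, ∀ t ∈ Set.Icc (0:ℝ) 1,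
      f (t * u + (1 - t) * v) ≤ t * f u + (1 - t) * f v - c * t * (1 - t) * (u - v) ^ 2) :
    (∑ i, (∑ j, p j * R i j) * f ((∑ j, q j * R i j) / (∑ j, p j * R i j)) ≤
        (∑ j, p j * f (q j / p j))
          - c * ((∑ j, p j * (q j / p j) ^ 2)
            - ∑ i, (∑ j, p j * R i j) * ((∑ j, q j * R i j) / (∑ j, p j * R i j)) ^ 2)) ∧
      (∑ j, p j * f (q j / p j))
          - c * ((∑ j, p j * (q j / p j) ^ 2)
            - ∑ i, (∑ j, p j * R i j) * ((∑ j, q j * R i j) / (∑ j, p j * R i j)) ^ 2) ≤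
        ∑ j, p j * f (q j / p j) := by
  have hconv : ConvexOn ℝ (Set.Icc α β) (fun x => f x - c * x ^ 2) := by
    refine ⟨convex_Icc α β, fun u hu v hv a b ha hb hab => ?_⟩
    obtain rfl : b = 1 - a := by linarith
    have h := hf u hu v hv a ⟨ha, by linarith⟩
    simp only [smul_eq_mul]
    linear_combination h
  have hsq : ConvexOn ℝ (Set.Icc α β) (fun x : ℝ => x ^ 2) :=
    even_two.convexOn_pow.subset (Set.subset_univ _) (convex_Icc α β)
  have h₁ := sum_mul_map_div_le_of_column_stochastic hconv hp hqp hR hRcol hpr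
  have h₂ := sum_mul_map_div_le_of_column_stochastic hsq hp hqp hR hRcol hpr
  simp only [mul_sub, Finset.sum_sub_distrib, mul_left_comm _ c, ← Finset.mul_sum] at h₁
  exact ⟨by linarith, sub_le_self _ (mul_nonneg hc.le (sub_nonneg.2 h₂))⟩
end

section
/- Let 0 < α < β with 1 ∈ [α,β], let p = (p₁,…,p_l), q = (q₁,…,q_l) be vectors with positive entries such that q_j/p_j ∈ [α,β] for all j and (Σ_{j=1}^l q_j)/(Σ_{j=1}^l p_j) ∈ [α,β]. Then for every f : [α,β] → ℝ strongly convex with modulus c > 0, (Σ_{j=1}^l p_j) f((Σ_{j=1}^l q_j)/(Σ_{j=1}^l p_j)) ≤ Σ_{j=1}^l p_j f(q_j/p_j) − c (Σ_{j=1}^l p_j (q_j/p_j)² − (Σ_{j=1}^l q_j)²/(Σ_{j=1}^l p_j)) ≤ Σ_{j=1}^l p_j f(q_j/p_j) ≤ ((Σ_{j=1}^l p_j β − Σ_{j=1}^l q_j)/(β − α)) f(α) + ((Σ_{j=1}^l q_j − Σ_{j=1}^l p_j α)/(β − α)) f(β) − c Σ_{j=1}^l p_j (β − q_j/p_j)(q_j/p_j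 − α). -/
/-- Jensen's inequality for the perspective `(p, q) ↦ p * g (q / p)` of a convex function. -/
lemma ConvexOn.sum_mul_map_sum_div_sum_le {ι : Type*} {s : Finset ι} {S : Set ℝ} {g : ℝ → ℝ}
    (hg : ConvexOn ℝ S g) {p q : ι → ℝ} (hp : ∀ j ∈ s, 0 < p j)
    (hS : ∀ j ∈ s, q j / p j ∈ S) :
    (∑ j ∈ s, p j) * g ((∑ j ∈ s, q j) / ∑ j ∈ s, p j) ≤ ∑ j ∈ s, p j * g (q j / p j) := by
  rcases s.eq_empty_or_nonempty with rfl | hs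
  · simp
  have hP : 0 < ∑ j ∈ s, p j := Finset.sum_pos hp hs
  have h := hg.map_centerMass_le (fun j hj => (hp j hj).le) hP hS
  have hq : ∑ j ∈ s, p j * (q j / p j) = ∑ j ∈ s, q j :=
    Finset.sum_congr rfl fun j hj => mul_div_cancel₀ _ (hp j hj).ne'
  simp only [Finset.centerMass, smul_eq_mul, Function.comp_apply, hq] at h
  rwa [inv_mul_eq_div, inv_mul_eq_div, le_div_iff₀' hP] at h

/-- A strongly convex function of modulus `c` is convex after subtracting `c * x ^ 2`. -/
lemma convexOn_sub_mul_sq {S : Set ℝ} (hS : Convex ℝ S) {f : ℝ → ℝ} {c : ℝ}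
    (hf : ∀ u ∈ S, ∀ v ∈ S, ∀ t ∈ Set.Icc (0:ℝ) 1,
      f (t * u + (1 - t) * v) ≤ t * f u + (1 - t) * f v - c * t * (1 - t) * (u - v) ^ 2) :
    ConvexOn ℝ S fun x => f x - c * x ^ 2 := by
  refine ⟨hS, fun u hu v hv a b ha hb hab => ?_⟩
  obtain rfl : b = 1 - a := by linarith
  have h := hf u hu v hv a ⟨ha, by linarith⟩
  simp only [smul_eq_mul]
  linarith

/-- The chord of a strongly convex function on `[α, β]`, lowered by a quadratic, lies above it. -/
lemma le_chord_sub_mul_of_strongly_convex {α β x c : ℝ} {f : ℝ → ℝ} (hαβ : α < β)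
    (hx : x ∈ Set.Icc α β)
    (hf : ∀ u ∈ Set.Icc α β, ∀ v ∈ Set.Icc α β, ∀ t ∈ Set.Icc (0:ℝ) 1,
      f (t * u + (1 - t) * v) ≤ t * f u + (1 - t) * f v - c * t * (1 - t) * (u - v) ^ 2) :
    f x ≤ (β - x) / (β - α) * f α + (x - α) / (β - α) * f β - c * ((β - x) * (x - α)) := by
  have hd : 0 < β - α := sub_pos.2 hαβ
  have h := hf α ⟨le_rfl, hαβ.le⟩ β ⟨hαβ.le, le_rfl⟩ ((β - x) / (β - α))
    ⟨div_nonneg (sub_nonneg.2 hx.2) hd.le, (div_le_one hd).2 (by linarith [hx.1])⟩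
  have ht : 1 - (β - x) / (β - α) = (x - α) / (β - α) := by
    field_simp
    ring
  have hcomb : (β - x) / (β - α) * α + (x - α) / (β - α) * β = x := by
    field_simp
    ring
  have hquad : c * ((β - x) / (β - α)) * ((x - α) / (β - α)) * (α - β) ^ 2
      = c * ((β - x) * (x - α)) := by
    field_simp
    ring
  rwa [ht, hcomb, hquad] at h


/-- Mutual bounds for the generalized f-divergence with r = (1,...,1). -/
theorem f_divergence_bounds_ones_strongly_convex
    (α β : ℝ) (hα : 0 < α) (hαβ : α < β) (h1 : (1:ℝ) ∈ Set.Icc α β) (l : ℕ)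
    (p q : Fin l → ℝ) (hp : ∀ j, 0 < p j) (hq : ∀ j, 0 < q j)
    (hqp : ∀ j, q j / p j ∈ Set.Icc α β)
    (hratio : (∑ j, q j) / (∑ j, p j) ∈ Set.Icc α β)
    (f : ℝ → ℝ) (c : ℝ) (hc : 0 < c)
    (hf : ∀ u ∈ Set.Icc α β, ∀ v ∈ Set.Icc α β, ∀ t ∈ Set.Icc (0:ℝ) 1,
      f (t * u + (1 - t) * v) ≤ t * f u + (1 - t) * f v - c * t * (1 - t) * (u - v) ^ 2) :
    ((∑ j, p j) * f ((∑ j, q j) / (∑ j, p j)) ≤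
        (∑ j, p j * f (q j / p j))
          - c * ((∑ j, p j * (q j / p j) ^ 2) - (∑ j, q j) ^ 2 / (∑ j, p j))) ∧
      ((∑ j, p j * f (q j / p j))
          - c * ((∑ j, p j * (q j / p j) ^ 2) - (∑ j, q j) ^ 2 / (∑ j, p j)) ≤
        ∑ j, p j * f (q j / p j)) ∧
      (∑ j, p j * f (q j / p j) ≤
        (((∑ j, p j) * β - ∑ j, q j) / (β - α)) * f α
          + (((∑ j, q j) - (∑ j, p j) * α) / (β - α)) * f β
          - c * ∑ j, p j * (β - q j / p j) * (q j / p j - α)) := by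
  have hP : (∑ j, p j) ≠ 0 := by
    intro h
    rw [h, div_zero] at hratio
    exact hα.not_ge hratio.1
  have hsq : (∑ j, q j) ^ 2 / (∑ j, p j) = (∑ j, p j) * ((∑ j, q j) / (∑ j, p j)) ^ 2 := by
    field_simp
  refine ⟨?_, ?_, ?_⟩
  · have h := (convexOn_sub_mul_sq (convex_Icc α β) hf).sum_mul_map_sum_div_sum_le
      (s := Finset.univ) (fun j _ => hp j) (fun j _ => hqp j)
    simp only [mul_sub, Finset.sum_sub_distrib, mul_left_comm _ c, ← Finset.mul_sum] at h
    rw [hsq]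
    linarith
  · have h := (even_two.convexOn_pow (𝕜 := ℝ)).sum_mul_map_sum_div_sum_le
      (s := Finset.univ) (fun j _ => hp j) (fun j _ => Set.mem_univ (q j / p j))
    rw [hsq]
    exact sub_le_self _ (mul_nonneg hc.le (sub_nonneg.2 h))
  · calc ∑ j, p j * f (q j / p j)
        ≤ ∑ j, ((p j * β - q j) / (β - α) * f α + (q j - p j * α) / (β - α) * f β
            - c * (p j * (β - q j / p j) * (q j / p j - α))) := by
          refine Finset.sum_le_sum fun j _ => ?_
          refine (mul_le_mul_of_nonneg_left
            (le_chord_sub_mul_of_strongly_convex hαβ (hqp j) hf) (hp j).le).trans_eq ?_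
          have hq_eq : q j = p j * (q j / p j) := (mul_div_cancel₀ _ (hp j).ne').symm
          generalize q j / p j = x at hq_eq ⊢
          rw [hq_eq]
          ring
      _ = _ := by
          simp only [Finset.sum_add_distrib, Finset.sum_sub_distrib, ← Finset.sum_mul,
            ← Finset.sum_div, ← Finset.mul_sum]
end

section
/- Let 0 < α < 1 < β, let p = (p₁,…,p_l), q = (q₁,…,q_l) be vectors with positive entries such that q_j/p_j ∈ [α,β] for all j and Σ_{j=1}^l p_j = Σ_{j=1}^l q_j. If f : [α,β] → ℝ is strongly convex with modulus c > 0 and normalized, i.e. f(1) = 0, then 0 ≤ Σ_{j=1}^l p_j f(q_j/p_j) − c (Σ_{j=1}^l p_j (q_j/p_j)² − Σ_{j=1}^l p_j) ≤ Σ_{j=1}^l p_j f(q_j/p_j) ≤ ((Σ_{j=1}^l p_j)(β − 1)/(β − α)) f(α) + ((Σ_{j=1}^l p_j)(1 − α)/(β − α)) f(β) − c Σ_{j=1}^l p_j (β − q_j/p_j)(q_j/p_j − α). -/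
theorem convexOn_Icc_sub_sq_of_strongly_convex {α β c : ℝ} {f : ℝ → ℝ}
    (hf : ∀ u ∈ Set.Icc α β, ∀ v ∈ Set.Icc α β, ∀ t ∈ Set.Icc (0:ℝ) 1,
      f (t * u + (1 - t) * v) ≤ t * f u + (1 - t) * f v - c * t * (1 - t) * (u - v) ^ 2) :
    ConvexOn ℝ (Set.Icc α β) fun x ↦ f x - c * x ^ 2 := by
  refine ⟨convex_Icc α β, fun u hu v hv a b ha hb hab ↦ ?_⟩
  obtain rfl : b = 1 - a := by linarith
  have h := hf u hu v hv a ⟨ha, by linarith⟩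
  simp only [smul_eq_mul]
  linear_combination h

theorem le_chord_sub_of_strongly_convex {α β c x : ℝ} {f : ℝ → ℝ} (hαβ : α < β)
    (hx : x ∈ Set.Icc α β)
    (hf : ∀ u ∈ Set.Icc α β, ∀ v ∈ Set.Icc α β, ∀ t ∈ Set.Icc (0:ℝ) 1,
      f (t * u + (1 - t) * v) ≤ t * f u + (1 - t) * f v - c * t * (1 - t) * (u - v) ^ 2) :
    f x ≤ (β - x) / (β - α) * f α + (x - α) / (β - α) * f β - c * ((β - x) * (x - α)) := by
  have hd : 0 < β - α := sub_pos.2 hαβ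
  have h := hf α (Set.left_mem_Icc.2 hαβ.le) β (Set.right_mem_Icc.2 hαβ.le) ((β - x) / (β - α))
    ⟨div_nonneg (sub_nonneg.2 hx.2) hd.le, (div_le_one hd).2 (by linarith [hx.1])⟩
  have ht : 1 - (β - x) / (β - α) = (x - α) / (β - α) := by field_simp; ring
  have hxe : (β - x) / (β - α) * α + (x - α) / (β - α) * β = x := by field_simp; ring
  have hsq : c * ((β - x) / (β - α)) * ((x - α) / (β - α)) * (α - β) ^ 2 =
      c * ((β - x) * (x - α)) := by
    field_simp
    ring
  rwa [ht, hxe, hsq] at h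

/-- Bounds for the generalized f-divergence of a normalized strongly convex function. -/
theorem f_divergence_bounds_normalized_strongly_convex
    (α β : ℝ) (hα : 0 < α) (hα1 : α < 1) (h1β : 1 < β) (l : ℕ)
    (p q : Fin l → ℝ) (hp : ∀ j, 0 < p j) (hq : ∀ j, 0 < q j)
    (hqp : ∀ j, q j / p j ∈ Set.Icc α β)
    (hpq : ∑ j, p j = ∑ j, q j)
    (f : ℝ → ℝ) (c : ℝ) (hc : 0 < c) (hnorm : f 1 = 0)
    (hf : ∀ u ∈ Set.Icc α β, ∀ v ∈ Set.Icc α β, ∀ t ∈ Set.Icc (0:ℝ) 1,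
      f (t * u + (1 - t) * v) ≤ t * f u + (1 - t) * f v - c * t * (1 - t) * (u - v) ^ 2) :
    (0 ≤ (∑ j, p j * f (q j / p j))
          - c * ((∑ j, p j * (q j / p j) ^ 2) - ∑ j, p j)) ∧
      ((∑ j, p j * f (q j / p j))
          - c * ((∑ j, p j * (q j / p j) ^ 2) - ∑ j, p j) ≤
        ∑ j, p j * f (q j / p j)) ∧
      (∑ j, p j * f (q j / p j) ≤
        ((∑ j, p j) * (β - 1) / (β - α)) * f α
          + ((∑ j, p j) * (1 - α) / (β - α)) * f β
          - c * ∑ j, p j * (β - q j / p j) * (q j / p j - α)) := by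
  have hqp' (j : Fin l) : p j * (q j / p j) = q j := mul_div_cancel₀ _ (hp j).ne'
  refine ⟨?_, sub_le_self _ (mul_nonneg hc.le ?_), ?_⟩
  · rcases isEmpty_or_nonempty (Fin l) with _ | _
    · simp
    have hP : 0 < ∑ j, p j := Finset.sum_pos (fun j _ ↦ hp j) Finset.univ_nonempty
    have h := (convexOn_Icc_sub_sq_of_strongly_convex hf).map_centerMass_le
      (t := Finset.univ) (w := p) (p := fun j ↦ q j / p j)
      (fun j _ ↦ (hp j).le) hP (fun j _ ↦ hqp j)
    simp only [Finset.centerMass, smul_eq_mul, Function.comp_apply, hqp', ← hpq,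
      inv_mul_cancel₀ hP.ne', hnorm] at h
    rw [inv_mul_eq_div, le_div_iff₀ hP] at h
    simp only [mul_sub, Finset.sum_sub_distrib, mul_left_comm _ c, ← Finset.mul_sum] at h
    linear_combination h
  · have h : ∑ j, 2 * (q j - p j) ≤ ∑ j, (p j * (q j / p j) ^ 2 - p j) :=
      Finset.sum_le_sum fun j _ ↦ by
        linear_combination mul_nonneg (hp j).le (sq_nonneg (q j / p j - 1)) - 2 * hqp' j
    rw [← Finset.mul_sum, Finset.sum_sub_distrib, Finset.sum_sub_distrib, ← hpq] at h
    linarith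
  · calc ∑ j, p j * f (q j / p j)
        ≤ ∑ j, ((p j * β - q j) * (f α / (β - α)) + (q j - p j * α) * (f β / (β - α))
            - c * (p j * (β - q j / p j) * (q j / p j - α))) :=
          Finset.sum_le_sum fun j _ ↦ by
            have h := mul_le_mul_of_nonneg_left
              (le_chord_sub_of_strongly_convex (hα1.trans h1β) (hqp j) hf) (hp j).le
            linear_combination h + (f β - f α) / (β - α) * hqp' j
      _ = _ := by
          simp only [Finset.sum_sub_distrib, Finset.sum_add_distrib, ← Finset.sum_mul,
            ← Finset.mul_sum, ← hpq]
          ring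
end

section
/- Let α < β, n ≥ 2, and let x = (x₁,…,x_l) ∈ [α,β]^l, y = (y₁,…,y_m) ∈ [α,β]^m, a ∈ [0,∞)^l, b ∈ [0,∞)^m be such that (y,b) ≺ (x,a) in the weighted majorization sense. Let k(t,x) = t − α for α ≤ t ≤ x ≤ β and k(t,x) = t − β for α ≤ x < t ≤ β. Then for every f : [α,β] → ℝ that is n times continuously differentiable, Σ_{j=1}^l a_j f(x_j) − Σ_{i=1}^m b_i f(y_i) = (1/(β − α)) Σ_{w=2}^{n−1} ((n − w)/w!) f^{(w−1)}(β) (Σ_{j=1}^l a_j (x_j − β)^w − Σ_{i=1}^m b_i (y_i − β)^w) − (1/(β − α)) Σ_{w=2}^{n−1} ((n − w)/w!) f^{(w−1)}(α) (Σ_{j=1}^l a_j (x_j − α)^w − Σ_{i=1}^m b_i (y_i − α)^w) + (1/((n−1)!(β − α))) ∫_α^β [Σ_{j=1}^l a_j (x_j − t)^{n−1} k(t, x_j) − Σ_{i=1}^m b_i (y_i − t)^{n−1} k(t, y_i)] f^{(n)}(t) dt. -/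
open Finset in
/-- Summation by parts for partial sums, weighted by the number of remaining terms. -/
lemma sum_range_succ_eq_mul_add_sum_sub (u : ℕ → ℝ) (N : ℕ) :
    ∑ w ∈ range (N + 1), u w =
      (N + 1) * u 0 + ∑ w ∈ range N, ((N : ℝ) - w) * (u (w + 1) - u w) := by
  induction N with
  | zero => simp
  | succ N ih =>
    have hsplit : ∑ w ∈ range N, (((N + 1 : ℕ) : ℝ) - w) * (u (w + 1) - u w) =
        ∑ w ∈ range N, ((N : ℝ) - w) * (u (w + 1) - u w) + (u N - u 0) := by
      rw [← sum_range_sub, ← sum_add_distrib]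
      refine sum_congr rfl fun w _ => ?_
      push_cast
      ring
    rw [sum_range_succ, ih, sum_range_succ _ N, hsplit]
    push_cast
    ring

/-- Derivative in the base point of a term of the Taylor expansion, lowered by one order. -/
lemma hasDerivAt_sub_pow_succ_mul_div_factorial {F G : ℝ → ℝ} {t : ℝ} (x : ℝ) (w : ℕ)
    (h : HasDerivAt F (G t) t) :
    HasDerivAt (fun s => (x - s) ^ (w + 1) * F s / (w + 1).factorial)
      ((x - t) ^ (w + 1) * G t / (w + 1).factorial - (x - t) ^ w * F t / w.factorial) t := by
  have hpow : HasDerivAt (fun s => (x - s) ^ (w + 1)) (-((w + 1 : ℕ) * (x - t) ^ w)) t := by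
    simpa using ((hasDerivAt_id t).const_sub x).fun_pow (w + 1)
  refine ((hpow.mul h).div_const _).congr_deriv ?_
  have : (w.factorial : ℝ) ≠ 0 := by positivity
  rw [Nat.factorial_succ]
  push_cast
  field_simp
  ring

/-- The Taylor polynomial at `x`, as a function of its base point. -/
lemma hasDerivAt_taylor_base {F : ℕ → ℝ → ℝ} {t : ℝ} (x : ℝ) (N : ℕ)
    (hF : ∀ w ≤ N, HasDerivAt (F w) (F (w + 1) t) t) :
    HasDerivAt (fun s => ∑ w ∈ Finset.range (N + 1), (x - s) ^ w * F w s / w.factorial)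
      ((x - t) ^ N * F (N + 1) t / N.factorial) t := by
  induction N with
  | zero => simpa using hF 0 le_rfl
  | succ N ih =>
    simp_rw [Finset.sum_range_succ _ (N + 1)]
    refine ((ih fun w hw => hF w (by omega)).add
      (hasDerivAt_sub_pow_succ_mul_div_factorial x N
        (F := F (N + 1)) (G := F (N + 2)) (hF (N + 1) le_rfl))).congr_deriv ?_
    ring

/-- A primitive of the integrand on each side of `x` in the Fink identity. -/
lemma hasDerivAt_fink_primitive {F : ℕ → ℝ → ℝ} {t : ℝ} (x c : ℝ) (N : ℕ)
    (hF : ∀ w ≤ N, HasDerivAt (F w) (F (w + 1) t) t) :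
    HasDerivAt (fun s => (s - c) * ∑ w ∈ Finset.range (N + 1), (x - s) ^ w * F w s / w.factorial
        - ∑ w ∈ Finset.range N,
          ((N : ℝ) - w) * ((x - s) ^ (w + 1) * F w s / (w + 1).factorial))
      ((x - t) ^ N * (t - c) * F (N + 1) t / N.factorial + (N + 1) * F 0 t) t := by
  have hsum : HasDerivAt (fun s => ∑ w ∈ Finset.range N,
        ((N : ℝ) - w) * ((x - s) ^ (w + 1) * F w s / (w + 1).factorial))
      (∑ w ∈ Finset.range N, ((N : ℝ) - w) *
        ((x - t) ^ (w + 1) * F (w + 1) t / (w + 1).factorial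
          - (x - t) ^ w * F w t / w.factorial)) t :=
    HasDerivAt.fun_sum fun w hw =>
      (hasDerivAt_sub_pow_succ_mul_div_factorial x w
        (hF w (Finset.mem_range.1 hw).le)).const_mul _
  refine ((((hasDerivAt_id t).sub_const c).mul (hasDerivAt_taylor_base x N hF)).sub
    hsum).congr_deriv ?_
  rw [sum_range_succ_eq_mul_add_sum_sub (fun w => (x - t) ^ w * F w t / w.factorial)]
  simp only [id, pow_zero, Nat.factorial_zero, Nat.cast_one]
  ring

/-- The Fink kernel remainder is integrable. -/
lemma intervalIntegrable_fink_kernel {α β x : ℝ} (hx : x ∈ Set.Icc α β) (N : ℕ) {g : ℝ → ℝ}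
    (hg : ContinuousOn g (Set.Icc α β)) :
    IntervalIntegrable
      (fun t => (x - t) ^ N * (if t ≤ x then t - α else t - β) * g t)
      MeasureTheory.volume α β := by
  have hl : IntervalIntegrable (fun t => (x - t) ^ N * (t - α) * g t)
      MeasureTheory.volume α x := by
    refine ContinuousOn.intervalIntegrable_of_Icc hx.1 ?_
    exact (by fun_prop : Continuous fun t => (x - t) ^ N * (t - α)).continuousOn.mul
      (hg.mono (Set.Icc_subset_Icc_right hx.2))
  have hr : IntervalIntegrable (fun t => (x - t) ^ N * (t - β) * g t)
      MeasureTheory.volume x β := by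
    refine ContinuousOn.intervalIntegrable_of_Icc hx.2 ?_
    exact (by fun_prop : Continuous fun t => (x - t) ^ N * (t - β)).continuousOn.mul
      (hg.mono (Set.Icc_subset_Icc_left hx.1))
  refine (hl.congr fun t ht => ?_).trans (hr.congr fun t ht => ?_)
  · rw [Set.uIoc_of_le hx.1] at ht
    simp [ht.2]
  · rw [Set.uIoc_of_le hx.2] at ht
    simp [not_le.2 ht.1]

/-- **Fink's identity**, for a chain `F 0, …, F (N + 1)` of successive derivatives. -/
theorem fink_identity {α β x : ℝ} (hx : x ∈ Set.Icc α β) (N : ℕ) {F : ℕ → ℝ → ℝ}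
    (hcont : ∀ w ≤ N + 1, ContinuousOn (F w) (Set.Icc α β))
    (hF : ∀ w ≤ N, ∀ t ∈ Set.Ioo α β, HasDerivAt (F w) (F (w + 1) t) t) :
    (β - α) * F 0 x = (N + 1) * (∫ t in α..β, F 0 t)
      + (∑ w ∈ Finset.range N,
          ((N : ℝ) - w) * ((x - β) ^ (w + 1) * F w β / (w + 1).factorial)
        - ∑ w ∈ Finset.range N,
          ((N : ℝ) - w) * ((x - α) ^ (w + 1) * F w α / (w + 1).factorial))
      + (∫ t in α..β, (x - t) ^ N * (if t ≤ x then t - α else t - β) * F (N + 1) t)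
        / N.factorial := by
  have hprim (c : ℝ) : ContinuousOn
      (fun s => (s - c) * ∑ w ∈ Finset.range (N + 1), (x - s) ^ w * F w s / w.factorial
        - ∑ w ∈ Finset.range N,
          ((N : ℝ) - w) * ((x - s) ^ (w + 1) * F w s / (w + 1).factorial)) (Set.Icc α β) := by
    have hterm (p w : ℕ) (q : ℝ) (hw : w ≤ N) :
        ContinuousOn (fun s => (x - s) ^ p * F w s / q) (Set.Icc α β) :=
      (((by fun_prop : Continuous fun s => (x - s) ^ p).continuousOn).mul
        (hcont w (by omega))).div_const q
    refine (((by fun_prop : Continuous fun s => s - c).continuousOn).mul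
      (continuousOn_finsetSum _ fun w hw => hterm w w _ ?_)).sub
      (continuousOn_finsetSum _ fun w hw => continuousOn_const.mul (hterm (w + 1) w _ ?_))
    · have := Finset.mem_range.1 hw; omega
    · have := Finset.mem_range.1 hw; omega
  have hder (c : ℝ) : ContinuousOn
      (fun t => (x - t) ^ N * (t - c) * F (N + 1) t / N.factorial) (Set.Icc α β) :=
    (((by fun_prop : Continuous fun t => (x - t) ^ N * (t - c)).continuousOn).mul
      (hcont (N + 1) le_rfl)).div_const _
  have hF0 : ContinuousOn (fun t => (N + 1 : ℝ) * F 0 t) (Set.Icc α β) :=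
    continuousOn_const.mul (hcont 0 (by omega))
  have hsubl : Set.Icc α x ⊆ Set.Icc α β := Set.Icc_subset_Icc_right hx.2
  have hsubr : Set.Icc x β ⊆ Set.Icc α β := Set.Icc_subset_Icc_left hx.1
  have hftcl := intervalIntegral.integral_eq_sub_of_hasDerivAt_of_le hx.1
    ((hprim α).mono hsubl)
    (fun t ht => hasDerivAt_fink_primitive x α N
      fun w hw => hF w hw t ⟨ht.1, ht.2.trans_le hx.2⟩)
    ((((hder α).add hF0).mono hsubl).intervalIntegrable_of_Icc hx.1)
  have hftcr := intervalIntegral.integral_eq_sub_of_hasDerivAt_of_le hx.2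
    ((hprim β).mono hsubr)
    (fun t ht => hasDerivAt_fink_primitive x β N
      fun w hw => hF w hw t ⟨hx.1.trans_lt ht.1, ht.2⟩)
    ((((hder β).add hF0).mono hsubr).intervalIntegrable_of_Icc hx.2)
  rw [intervalIntegral.integral_add
    (((hder α).mono hsubl).intervalIntegrable_of_Icc hx.1)
    ((hF0.mono hsubl).intervalIntegrable_of_Icc hx.1),
    intervalIntegral.integral_div, intervalIntegral.integral_const_mul] at hftcl
  rw [intervalIntegral.integral_add
    (((hder β).mono hsubr).intervalIntegrable_of_Icc hx.2)
    ((hF0.mono hsubr).intervalIntegrable_of_Icc hx.2),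
    intervalIntegral.integral_div, intervalIntegral.integral_const_mul] at hftcr
  have hxm : x ∈ Set.uIcc α β := Set.uIcc_of_le (hx.1.trans hx.2) ▸ hx
  have hsub1 : Set.uIcc α x ⊆ Set.uIcc α β := Set.uIcc_subset_uIcc_left hxm
  have hsub2 : Set.uIcc x β ⊆ Set.uIcc α β := Set.uIcc_subset_uIcc_right hxm
  have hI := intervalIntegrable_fink_kernel hx N (hcont (N + 1) le_rfl)
  have hI0 := (hcont 0 (by omega)).intervalIntegrable_of_Icc
    (μ := MeasureTheory.volume) (hx.1.trans hx.2)
  have hsplit0 := intervalIntegral.integral_add_adjacent_intervals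
    (hI0.mono_set hsub1) (hI0.mono_set hsub2)
  have hsplit := intervalIntegral.integral_add_adjacent_intervals
    (hI.mono_set hsub1) (hI.mono_set hsub2)
  have hkl : ∫ t in α..x, (x - t) ^ N * (if t ≤ x then t - α else t - β) * F (N + 1) t =
      ∫ t in α..x, (x - t) ^ N * (t - α) * F (N + 1) t := by
    refine intervalIntegral.integral_congr_uIoo fun t ht => ?_
    rw [Set.uIoo_of_le hx.1] at ht
    simp [ht.2.le]
  have hkr : ∫ t in x..β, (x - t) ^ N * (if t ≤ x then t - α else t - β) * F (N + 1) t =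
      ∫ t in x..β, (x - t) ^ N * (t - β) * F (N + 1) t := by
    refine intervalIntegral.integral_congr_uIoo fun t ht => ?_
    rw [Set.uIoo_of_le hx.2] at ht
    simp [not_le.2 ht.1]
  have hT : ∑ w ∈ Finset.range (N + 1), (x - x) ^ w * F w x / w.factorial = F 0 x := by
    rw [Finset.sum_range_succ']
    simp
  rw [hkl, hkr] at hsplit
  rw [← hsplit0, ← hsplit]
  rw [hT] at hftcl hftcr
  simp only [sub_self, zero_mul, zero_sub] at hftcl hftcr
  linear_combination -hftcl - hftcr


/-- Fink-identity representation of the Sherman difference. -/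
theorem sherman_difference_fink_identity
    (α β : ℝ) (hαβ : α < β) (n l m : ℕ) (hn : 2 ≤ n)
    (x : Fin l → ℝ) (hx : ∀ j, x j ∈ Set.Icc α β)
    (y : Fin m → ℝ) (hy : ∀ i, y i ∈ Set.Icc α β)
    (a : Fin l → ℝ) (ha : ∀ j, 0 ≤ a j)
    (b : Fin m → ℝ) (hb : ∀ i, 0 ≤ b i)
    (A : Fin m → Fin l → ℝ) (hA : ∀ i j, 0 ≤ A i j) (hArow : ∀ i, ∑ j, A i j = 1)
    (haA : ∀ j, a j = ∑ i, b i * A i j) (hyA : ∀ i, y i = ∑ j, A i j * x j)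
    (k : ℝ → ℝ → ℝ) (hk : ∀ t u, k t u = if t ≤ u then t - α else t - β)
    (f : ℝ → ℝ) (hf : ContDiffOn ℝ n f (Set.Icc α β)) :
    (∑ j, a j * f (x j)) - ∑ i, b i * f (y i) =
      (1 / (β - α)) * ∑ w ∈ Finset.Icc 2 (n - 1),
          (((n : ℝ) - w) / (Nat.factorial w)) *
            iteratedDerivWithin (w - 1) f (Set.Icc α β) β *
            ((∑ j, a j * (x j - β) ^ w) - ∑ i, b i * (y i - β) ^ w)
        - (1 / (β - α)) * ∑ w ∈ Finset.Icc 2 (n - 1),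
            (((n : ℝ) - w) / (Nat.factorial w)) *
              iteratedDerivWithin (w - 1) f (Set.Icc α β) α *
              ((∑ j, a j * (x j - α) ^ w) - ∑ i, b i * (y i - α) ^ w)
        + (1 / ((Nat.factorial (n - 1)) * (β - α))) *
            ∫ t in α..β,
              ((∑ j, a j * (x j - t) ^ (n - 1) * k t (x j))
                - ∑ i, b i * (y i - t) ^ (n - 1) * k t (y i)) *
                iteratedDerivWithin n f (Set.Icc α β) t := by
  obtain ⟨N, rfl⟩ : ∃ N, n = N + 2 := ⟨n - 2, by omega⟩
  have hβα : β - α ≠ 0 := (sub_pos.2 hαβ).ne'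
  set D : ℕ → ℝ → ℝ := fun w => iteratedDerivWithin w f (Set.Icc α β) with hD
  have huniq := uniqueDiffOn_Icc hαβ
  have hcont : ∀ w ≤ N + 1 + 1, ContinuousOn (D w) (Set.Icc α β) := fun w hw =>
    hf.continuousOn_iteratedDerivWithin (by exact_mod_cast hw) huniq
  have hder : ∀ w ≤ N + 1, ∀ t ∈ Set.Ioo α β, HasDerivAt (D w) (D (w + 1) t) t := by
    intro w hw t ht
    have hdiff := hf.differentiableOn_iteratedDerivWithin (m := w)
      (by exact_mod_cast Nat.lt_succ_of_le hw) huniq t (Set.Ioo_subset_Icc_self ht)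
    simpa only [hD, iteratedDerivWithin_succ] using
      hdiff.hasDerivWithinAt.hasDerivAt (Icc_mem_nhds ht.1 ht.2)
  have hfink (u : ℝ) (hu : u ∈ Set.Icc α β) := fink_identity hu (N + 1) hcont hder
  have hmass : ∑ j, a j = ∑ i, b i := by
    simp_rw [haA]
    rw [Finset.sum_comm]
    simp_rw [← Finset.mul_sum, hArow, mul_one]
  have hmean : ∑ j, a j * x j = ∑ i, b i * y i := by
    simp_rw [haA, hyA, Finset.sum_mul, Finset.mul_sum]
    rw [Finset.sum_comm]
    simp_rw [mul_assoc]
  have hcenter (c : ℝ) : ∑ j, a j * (x j - c) - ∑ i, b i * (y i - c) = 0 := by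
    simp_rw [mul_sub, Finset.sum_sub_distrib, ← Finset.sum_mul]
    rw [hmass, hmean]
    ring
  have hcombine (c : ℝ) :
      ∑ j, a j * ∑ w ∈ Finset.range (N + 1), (((N + 1 : ℕ) : ℝ) - w) *
          ((x j - c) ^ (w + 1) * D w c / (w + 1).factorial)
        - ∑ i, b i * ∑ w ∈ Finset.range (N + 1), (((N + 1 : ℕ) : ℝ) - w) *
          ((y i - c) ^ (w + 1) * D w c / (w + 1).factorial) =
      ∑ w ∈ Finset.Icc 2 (N + 2 - 1),
        ((((N + 2 : ℕ) : ℝ) - w) / w.factorial) * D (w - 1) c *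
          ((∑ j, a j * (x j - c) ^ w) - ∑ i, b i * (y i - c) ^ w) := by
    have hIcc : Finset.Icc 2 (N + 2 - 1) = Finset.Ico 2 (N + 2) := by
      ext w
      simp only [Finset.mem_Icc, Finset.mem_Ico]
      omega
    rw [hIcc, Finset.sum_Ico_eq_sum_range, Nat.add_sub_cancel]
    simp_rw [Finset.mul_sum]
    rw [Finset.sum_comm, Finset.sum_comm (s := (Finset.univ : Finset (Fin m))),
      ← Finset.sum_sub_distrib]
    have hterm (w : ℕ) :
        ∑ j, a j * ((((N + 1 : ℕ) : ℝ) - w) *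
            ((x j - c) ^ (w + 1) * D w c / (w + 1).factorial))
          - ∑ i, b i * ((((N + 1 : ℕ) : ℝ) - w) *
            ((y i - c) ^ (w + 1) * D w c / (w + 1).factorial)) =
        ((((N + 1 : ℕ) : ℝ) - w) / (w + 1).factorial) * D w c *
          ((∑ j, a j * (x j - c) ^ (w + 1)) - ∑ i, b i * (y i - c) ^ (w + 1)) := by
      rw [mul_sub, Finset.mul_sum, Finset.mul_sum]
      congr 1 <;> exact Finset.sum_congr rfl fun _ _ => by ring
    simp_rw [hterm]
    rw [Finset.sum_range_succ']
    simp only [zero_add, pow_one, hcenter, mul_zero, add_zero]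
    refine Finset.sum_congr rfl fun w _ => ?_
    rw [show 2 + w = w + 1 + 1 by ring, Nat.add_sub_cancel]
    push_cast
    ring
  have hint (u : ℝ) (hu : u ∈ Set.Icc α β) :=
    intervalIntegrable_fink_kernel hu (N + 1) (hcont (N + 2) le_rfl)
  have hint_sum {p : ℕ} (c z : Fin p → ℝ) (hz : ∀ j, z j ∈ Set.Icc α β) :
      IntervalIntegrable (fun t => ∑ j, c j *
        ((z j - t) ^ (N + 1) * (if t ≤ z j then t - α else t - β) * D (N + 2) t))
        MeasureTheory.volume α β := by
    simpa only [Finset.sum_fn] using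
      IntervalIntegrable.sum Finset.univ fun j _ => (hint _ (hz j)).const_mul (c j)
  have hintegral : ∫ t in α..β,
        ((∑ j, a j * (x j - t) ^ (N + 2 - 1) * k t (x j))
          - ∑ i, b i * (y i - t) ^ (N + 2 - 1) * k t (y i)) * D (N + 2) t =
      ∑ j, a j * (∫ t in α..β,
          (x j - t) ^ (N + 1) * (if t ≤ x j then t - α else t - β) * D (N + 2) t)
        - ∑ i, b i * ∫ t in α..β,
          (y i - t) ^ (N + 1) * (if t ≤ y i then t - α else t - β) * D (N + 2) t := by
    simp_rw [← intervalIntegral.integral_const_mul]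
    rw [← intervalIntegral.integral_finsetSum fun j _ => (hint _ (hx j)).const_mul _,
      ← intervalIntegral.integral_finsetSum fun i _ => (hint _ (hy i)).const_mul _,
      ← intervalIntegral.integral_sub
        (hint_sum a x hx) (hint_sum b y hy)]
    refine intervalIntegral.integral_congr fun t _ => ?_
    simp only [hk, sub_mul, Finset.sum_mul, mul_assoc,
      show N + 2 - 1 = N + 1 from rfl]
  have hD0 : D 0 = f := iteratedDerivWithin_zero
  have hsum {p : ℕ} (c z : Fin p → ℝ) (hz : ∀ j, z j ∈ Set.Icc α β) :
      (β - α) * ∑ j, c j * f (z j) =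
        (∑ j, c j) * (((N + 1 : ℕ) + 1) * ∫ t in α..β, D 0 t)
        + (∑ j, c j * ∑ w ∈ Finset.range (N + 1), (((N + 1 : ℕ) : ℝ) - w) *
            ((z j - β) ^ (w + 1) * D w β / (w + 1).factorial)
          - ∑ j, c j * ∑ w ∈ Finset.range (N + 1), (((N + 1 : ℕ) : ℝ) - w) *
            ((z j - α) ^ (w + 1) * D w α / (w + 1).factorial))
        + (∑ j, c j * ∫ t in α..β,
            (z j - t) ^ (N + 1) * (if t ≤ z j then t - α else t - β) * D (N + 2) t)
          / (N + 1).factorial := by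
    rw [Finset.mul_sum, Finset.sum_mul, Finset.sum_div, ← Finset.sum_sub_distrib,
      ← Finset.sum_add_distrib, ← Finset.sum_add_distrib]
    refine Finset.sum_congr rfl fun j _ => ?_
    rw [mul_left_comm, ← hD0, hfink _ (hz j)]
    ring
  have hDapply (w : ℕ) (t : ℝ) : iteratedDerivWithin w f (Set.Icc α β) t = D w t := rfl
  simp only [hDapply]
  rw [hintegral, ← hcombine β, ← hcombine α, show N + 2 - 1 = N + 1 from rfl]
  have hfact : ((N + 1).factorial : ℝ) ≠ 0 := by positivity
  refine mul_left_cancel₀ hβα ?_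
  rw [mul_sub, hsum a x hx, hsum b y hy, hmass]
  field_simp
  ring
end

section
/- Let α < β, n ≥ 2, and let x = (x₁,…,x_l) ∈ [α,β]^l, y = (y₁,…,y_m) ∈ [α,β]^m, a ∈ [0,∞)^l, b ∈ [0,∞)^m be such that (y,b) ≺ (x,a) in the weighted majorization sense. Let k(t,x) be the Fink kernel on [α,β]. Let f : [α,β] → ℝ be n times continuously differentiable with f^{(n)}(t) ≥ c·n! on [α,β] for some c > 0 (i.e., f is strongly n-convex with modulus c). If Σ_{j=1}^l a_j (x_j − t)^{n−1} k(t, x_j) − Σ_{i=1}^m b_i (y_i − t)^{n−1} k(t, y_i) ≥ 0 for all t ∈ [α,β], then, writing g(x) = f(x) − c·xⁿ, Σ_{j=1}^l a_j f(x_j) − Σ_{i=1}^m b_i f(y_i) − c (Σ_{j=1}^l a_j x_jⁿ − Σ_{i=1}^m b_i y_iⁿ) ≥ (1/(β − α)) Σ_{w=2}^{n−1} ((n − w)/w!) g^{(w−1)}(β) (Σ_{j=1}^l a_j (x_j − β)^w − Σ_{i=1}^m b_i (y_i − β)^w) − (1/(β − α)) Σ_{w=2}^{n−1} ((n − w)/w!)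 g^{(w−1)}(α) (Σ_{j=1}^l a_j (x_j − α)^w − Σ_{i=1}^m b_i (y_i − α)^w). If the reverse inequality for the kernel expression holds for all t ∈ [α,β], then the reverse of the displayed inequality holds. -/
open Set intervalIntegral in
/-- The integral form of the Taylor remainder, for a family `G` in which `G (i + 1)` is the
derivative of `G i`, expressed through the mean of `G 0`. -/
theorem integral_sub_pow_mul_eq_taylor {p u : ℝ} {G : ℕ → ℝ → ℝ} (N : ℕ)
    (hG : ∀ i < N, ∀ t ∈ uIcc p u, HasDerivWithinAt (G i) (G (i + 1) t) (uIcc p u) t)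
    (hc : ∀ i ≤ N, ContinuousOn (G i) (uIcc p u)) :
    ∫ t in p..u, (u - t) ^ N * G N t = (N.factorial : ℝ) * ((∫ t in p..u, G 0 t)
      - ∑ w ∈ Finset.Icc 1 N, G (w - 1) p * (u - p) ^ w / (w.factorial : ℝ)) := by
  induction N with
  | zero => simp
  | succ N ih =>
    have ih := ih (fun i hi ↦ hG i (by omega)) (fun i hi ↦ hc i (by omega))
    have hpow : ∀ t ∈ uIcc p u, HasDerivWithinAt (fun t ↦ (u - t) ^ (N + 1))
        (-((N + 1 : ℝ) * (u - t) ^ N)) (uIcc p u) t := fun t _ ↦ by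
      have := (((hasDerivAt_id t).const_sub u).pow (N + 1)).hasDerivWithinAt (s := uIcc p u)
      convert! this using 1
      simp
    have hparts := integral_mul_deriv_eq_deriv_mul_of_hasDerivWithinAt hpow (hG N (by omega))
      (Continuous.intervalIntegrable (by fun_prop) _ _) (hc (N + 1) le_rfl).intervalIntegrable
    have hint : ∫ t in p..u, -((N + 1 : ℝ) * (u - t) ^ N) * G N t
        = -(N + 1 : ℝ) * ∫ t in p..u, (u - t) ^ N * G N t := by
      rw [← intervalIntegral.integral_const_mul]
      exact integral_congr fun t _ ↦ by ring
    rw [hparts, hint, ih, Finset.sum_Icc_succ_top (by omega), Nat.add_sub_cancel,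
      Nat.factorial_succ]
    have : (N.factorial : ℝ) ≠ 0 := by positivity
    push_cast
    field_simp
    ring

open Set intervalIntegral in
/-- One-sided form of Fink's identity. -/
theorem integral_sub_pow_mul_sub_mul_eq {p u : ℝ} {G : ℕ → ℝ → ℝ} (N : ℕ)
    (hG : ∀ i < N + 1, ∀ t ∈ uIcc p u, HasDerivWithinAt (G i) (G (i + 1) t) (uIcc p u) t)
    (hc : ∀ i ≤ N + 1, ContinuousOn (G i) (uIcc p u)) :
    ∫ t in p..u, (u - t) ^ N * (t - p) * G (N + 1) t =
      (N.factorial : ℝ) * ((u - p) * G 0 u - (N + 1) * (∫ t in p..u, G 0 t)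
        + ∑ w ∈ Finset.Icc 1 N,
            ((N + 1 : ℝ) - w) / (w.factorial : ℝ) * G (w - 1) p * (u - p) ^ w) := by
  induction N with
  | zero =>
    have hparts := integral_mul_deriv_eq_deriv_mul_of_hasDerivWithinAt
      (fun t _ ↦ ((hasDerivAt_id t).sub_const p).hasDerivWithinAt (s := uIcc p u))
      (hG 0 (by omega))
      (Continuous.intervalIntegrable (by fun_prop) _ _) (hc 1 le_rfl).intervalIntegrable
    simpa using hparts
  | succ N ih =>
    have ih := ih (fun i hi ↦ hG i (by omega)) (fun i hi ↦ hc i (by omega))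
    have htaylor := integral_sub_pow_mul_eq_taylor (p := p) (u := u) (G := G) (N + 1)
      (fun i hi ↦ hG i (by omega)) (fun i hi ↦ hc i (by omega))
    have hpow : ∀ t ∈ uIcc p u, HasDerivWithinAt (fun t ↦ (u - t) ^ (N + 1) * (t - p))
        (-((N + 1 : ℝ) * (u - t) ^ N) * (t - p) + (u - t) ^ (N + 1)) (uIcc p u) t := fun t _ ↦ by
      have := ((((hasDerivAt_id t).const_sub u).pow (N + 1)).mul
        ((hasDerivAt_id t).sub_const p)).hasDerivWithinAt (s := uIcc p u)
      convert! this using 1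
      simp
    have hparts := integral_mul_deriv_eq_deriv_mul_of_hasDerivWithinAt hpow (hG (N + 1) (by omega))
      (Continuous.intervalIntegrable (by fun_prop) _ _) (hc (N + 2) le_rfl).intervalIntegrable
    have hcont := hc (N + 1) (by omega)
    have hint : ∫ t in p..u,
          (-((N + 1 : ℝ) * (u - t) ^ N) * (t - p) + (u - t) ^ (N + 1)) * G (N + 1) t
        = -(N + 1 : ℝ) * (∫ t in p..u, (u - t) ^ N * (t - p) * G (N + 1) t)
          + ∫ t in p..u, (u - t) ^ (N + 1) * G (N + 1) t := by
      rw [← intervalIntegral.integral_const_mul, ← intervalIntegral.integral_add]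
      · exact integral_congr fun t _ ↦ by ring
      · exact ContinuousOn.intervalIntegrable (by fun_prop)
      · exact ContinuousOn.intervalIntegrable (by fun_prop)
    have hsum : ∑ w ∈ Finset.Icc 1 (N + 1),
          (((N + 1 : ℕ) + 1 : ℝ) - w) / (w.factorial : ℝ) * G (w - 1) p * (u - p) ^ w
        = ∑ w ∈ Finset.Icc 1 N,
            ((N + 1 : ℝ) - w) / (w.factorial : ℝ) * G (w - 1) p * (u - p) ^ w
          + ∑ w ∈ Finset.Icc 1 (N + 1), G (w - 1) p * (u - p) ^ w / (w.factorial : ℝ) := by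
      have hlast : ∑ w ∈ Finset.Icc 1 N,
            ((N + 1 : ℝ) - w) / (w.factorial : ℝ) * G (w - 1) p * (u - p) ^ w
          = ∑ w ∈ Finset.Icc 1 (N + 1),
            ((N + 1 : ℝ) - w) / (w.factorial : ℝ) * G (w - 1) p * (u - p) ^ w := by
        rw [Finset.sum_Icc_succ_top (by omega)]
        simp
      rw [hlast, ← Finset.sum_add_distrib]
      refine Finset.sum_congr rfl fun w _ ↦ ?_
      push_cast
      ring
    rw [hparts, hint, ih, htaylor, hsum, Nat.factorial_succ]
    push_cast
    ring

open Set intervalIntegral in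
/-- Fink's identity, with the integrability of the remainder. -/
theorem fink_identity_s15 {α β u : ℝ} (hu : u ∈ Icc α β) {G : ℕ → ℝ → ℝ} {k : ℝ → ℝ → ℝ}
    (hk : ∀ t v, k t v = if t ≤ v then t - α else t - β) (N : ℕ)
    (hG : ∀ i < N + 1, ∀ t ∈ Icc α β, HasDerivWithinAt (G i) (G (i + 1) t) (Icc α β) t)
    (hc : ∀ i ≤ N + 1, ContinuousOn (G i) (Icc α β)) :
    IntervalIntegrable (fun t ↦ (u - t) ^ N * k t u * G (N + 1) t) MeasureTheory.volume α β ∧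
    ∫ t in α..β, (u - t) ^ N * k t u * G (N + 1) t =
      (N.factorial : ℝ) * ((β - α) * G 0 u - (N + 1) * (∫ t in α..β, G 0 t)
        + ∑ w ∈ Finset.Icc 1 N, ((N + 1 : ℝ) - w) / (w.factorial : ℝ) *
            (G (w - 1) α * (u - α) ^ w - G (w - 1) β * (u - β) ^ w)) := by
  obtain ⟨h₁, h₂⟩ := hu
  have hsubα : uIcc α u ⊆ Icc α β := by
    rw [uIcc_of_le h₁]; exact Icc_subset_Icc_right h₂
  have hsubβ : uIcc β u ⊆ Icc α β := by
    rw [uIcc_of_ge h₂]; exact Icc_subset_Icc_left h₁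
  have hα := integral_sub_pow_mul_sub_mul_eq (p := α) (u := u) (G := G) N
    (fun i hi t ht ↦ (hG i hi t (hsubα ht)).mono hsubα) (fun i hi ↦ (hc i hi).mono hsubα)
  have hβ := integral_sub_pow_mul_sub_mul_eq (p := β) (u := u) (G := G) N
    (fun i hi t ht ↦ (hG i hi t (hsubβ ht)).mono hsubβ) (fun i hi ↦ (hc i hi).mono hsubβ)
  have hcα := (hc (N + 1) le_rfl).mono hsubα
  have hcβ := (hc (N + 1) le_rfl).mono hsubβ
  have hIα : IntervalIntegrable (fun t ↦ (u - t) ^ N * (t - α) * G (N + 1) t)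
      MeasureTheory.volume α u := ContinuousOn.intervalIntegrable (by fun_prop)
  have hIβ : IntervalIntegrable (fun t ↦ (u - t) ^ N * (t - β) * G (N + 1) t)
      MeasureTheory.volume u β := by
    refine IntervalIntegrable.symm (ContinuousOn.intervalIntegrable (by fun_prop))
  have heα : EqOn (fun t ↦ (u - t) ^ N * (t - α) * G (N + 1) t)
      (fun t ↦ (u - t) ^ N * k t u * G (N + 1) t) (uIoc α u) := fun t ht ↦ by
    rw [uIoc_of_le h₁] at ht
    simp [hk, ht.2]
  have heβ : EqOn (fun t ↦ (u - t) ^ N * (t - β) * G (N + 1) t)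
      (fun t ↦ (u - t) ^ N * k t u * G (N + 1) t) (uIoc u β) := fun t ht ↦ by
    rw [uIoc_of_le h₂] at ht
    simp [hk, ht.1.not_ge]
  have hJα := hIα.congr heα
  have hJβ := hIβ.congr heβ
  refine ⟨hJα.trans hJβ, ?_⟩
  have hsplit : (∫ t in α..β, G 0 t) = (∫ t in α..u, G 0 t) - ∫ t in β..u, G 0 t := by
    rw [intervalIntegral.integral_symm u β, sub_neg_eq_add]
    exact (integral_add_adjacent_intervals ((hc 0 (by omega)).mono hsubα).intervalIntegrable
      ((hc 0 (by omega)).mono hsubβ).intervalIntegrable.symm).symm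
  rw [← integral_add_adjacent_intervals hJα hJβ,
    ← integral_congr_ae (Filter.Eventually.of_forall heα),
    ← integral_congr_ae (Filter.Eventually.of_forall heβ),
    intervalIntegral.integral_symm β u, hα, hβ, hsplit]
  simp only [mul_sub, Finset.sum_sub_distrib, ← mul_assoc]
  ring

open Set intervalIntegral in
/-- Fink's identity applied to a signed combination of points that annihilates affine functions. -/
theorem fink_identity_sum {ι : Type*} [Fintype ι] {α β : ℝ} {z q : ι → ℝ}
    (hz : ∀ i, z i ∈ Icc α β) (hq : ∑ i, q i = 0) (hqz : ∑ i, q i * z i = 0)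
    {G : ℕ → ℝ → ℝ} {k : ℝ → ℝ → ℝ}
    (hk : ∀ t v, k t v = if t ≤ v then t - α else t - β) (N : ℕ) (hN : 1 ≤ N)
    (hG : ∀ i < N + 1, ∀ t ∈ Icc α β, HasDerivWithinAt (G i) (G (i + 1) t) (Icc α β) t)
    (hc : ∀ i ≤ N + 1, ContinuousOn (G i) (Icc α β)) :
    ∫ t in α..β, (∑ i, q i * (z i - t) ^ N * k t (z i)) * G (N + 1) t =
      (N.factorial : ℝ) * ((β - α) * (∑ i, q i * G 0 (z i))
        + ∑ w ∈ Finset.Icc 2 N, ((N + 1 : ℝ) - w) / (w.factorial : ℝ) *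
            (G (w - 1) α * (∑ i, q i * (z i - α) ^ w)
              - G (w - 1) β * (∑ i, q i * (z i - β) ^ w))) := by
  have hfink := fun i ↦ fink_identity_s15 (hz i) hk N hG hc
  have hlin (r : ℝ) : ∑ i, q i * (z i - r) ^ 1 = 0 := by
    simp [mul_sub, Finset.sum_sub_distrib, ← Finset.sum_mul, hq, hqz]
  have hIcc : ∑ w ∈ Finset.Icc 1 N, ((N + 1 : ℝ) - w) / (w.factorial : ℝ) *
            (G (w - 1) α * (∑ i, q i * (z i - α) ^ w)
              - G (w - 1) β * (∑ i, q i * (z i - β) ^ w))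
      = ∑ w ∈ Finset.Icc 2 N, ((N + 1 : ℝ) - w) / (w.factorial : ℝ) *
            (G (w - 1) α * (∑ i, q i * (z i - α) ^ w)
              - G (w - 1) β * (∑ i, q i * (z i - β) ^ w)) := by
    rw [← Finset.add_sum_Ioc_eq_sum_Icc hN, hlin, hlin]
    simp only [mul_zero, sub_zero, zero_add]
    rfl
  have hsum : ∑ w ∈ Finset.Icc 1 N, ((N + 1 : ℝ) - w) / (w.factorial : ℝ) *
            (G (w - 1) α * (∑ i, q i * (z i - α) ^ w)
              - G (w - 1) β * (∑ i, q i * (z i - β) ^ w))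
      = ∑ i, q i * ∑ w ∈ Finset.Icc 1 N, ((N + 1 : ℝ) - w) / (w.factorial : ℝ) *
            (G (w - 1) α * (z i - α) ^ w - G (w - 1) β * (z i - β) ^ w) := by
    simp only [Finset.mul_sum]
    rw [Finset.sum_comm]
    refine Finset.sum_congr rfl fun w _ ↦ ?_
    rw [← Finset.sum_sub_distrib, Finset.mul_sum]
    exact Finset.sum_congr rfl fun i _ ↦ by ring
  calc ∫ t in α..β, (∑ i, q i * (z i - t) ^ N * k t (z i)) * G (N + 1) t
      = ∫ t in α..β, ∑ i, q i * ((z i - t) ^ N * k t (z i) * G (N + 1) t) := by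
        refine integral_congr fun t _ ↦ ?_
        simp only [Finset.sum_mul]
        exact Finset.sum_congr rfl fun i _ ↦ by ring
    _ = ∑ i, q i * ∫ t in α..β, (z i - t) ^ N * k t (z i) * G (N + 1) t := by
        rw [intervalIntegral.integral_finsetSum fun i _ ↦ (hfink i).1.const_mul (q i)]
        simp only [intervalIntegral.integral_const_mul]
    _ = _ := by
        have hdistrib (T : ι → ℝ) (r s I : ℝ) :
            ∑ i, q i * (r * (s * G 0 (z i) - I + T i))
              = r * (s * (∑ i, q i * G 0 (z i)) + ∑ i, q i * T i) := by
          have hI : ∑ i, q i * I = 0 := by rw [← Finset.sum_mul, hq, zero_mul]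
          rw [← sub_zero (s * _), ← hI, Finset.mul_sum, ← Finset.sum_sub_distrib,
            ← Finset.sum_add_distrib, Finset.mul_sum]
          exact Finset.sum_congr rfl fun i _ ↦ by ring
        rw [← hIcc, hsum, ← hdistrib]
        exact Finset.sum_congr rfl fun i _ ↦ by rw [(hfink i).2]

/-- Sherman-type inequality for strongly n-convex functions via Fink's identity. -/
theorem sherman_strongly_n_convex_fink
    (α β : ℝ) (hαβ : α < β) (n l m : ℕ) (hn : 2 ≤ n)
    (x : Fin l → ℝ) (hx : ∀ j, x j ∈ Set.Icc α β)
    (y : Fin m → ℝ) (hy : ∀ i, y i ∈ Set.Icc α β)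
    (a : Fin l → ℝ) (ha : ∀ j, 0 ≤ a j)
    (b : Fin m → ℝ) (hb : ∀ i, 0 ≤ b i)
    (A : Fin m → Fin l → ℝ) (hA : ∀ i j, 0 ≤ A i j) (hArow : ∀ i, ∑ j, A i j = 1)
    (haA : ∀ j, a j = ∑ i, b i * A i j) (hyA : ∀ i, y i = ∑ j, A i j * x j)
    (k : ℝ → ℝ → ℝ) (hk : ∀ t u, k t u = if t ≤ u then t - α else t - β)
    (f : ℝ → ℝ) (hf : ContDiffOn ℝ n f (Set.Icc α β))
    (c : ℝ) (hc : 0 < c)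
    (hfn : ∀ t ∈ Set.Icc α β,
      c * (Nat.factorial n) ≤ iteratedDerivWithin n f (Set.Icc α β) t)
    (g : ℝ → ℝ) (hg : ∀ u, g u = f u - c * u ^ n) :
    ((∀ t ∈ Set.Icc α β,
        0 ≤ (∑ j, a j * (x j - t) ^ (n - 1) * k t (x j))
              - ∑ i, b i * (y i - t) ^ (n - 1) * k t (y i)) →
      (∑ j, a j * f (x j)) - (∑ i, b i * f (y i))
          - c * ((∑ j, a j * x j ^ n) - ∑ i, b i * y i ^ n) ≥
        (1 / (β - α)) * ∑ w ∈ Finset.Icc 2 (n - 1),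
            (((n : ℝ) - w) / (Nat.factorial w)) *
              iteratedDerivWithin (w - 1) g (Set.Icc α β) β *
              ((∑ j, a j * (x j - β) ^ w) - ∑ i, b i * (y i - β) ^ w)
          - (1 / (β - α)) * ∑ w ∈ Finset.Icc 2 (n - 1),
              (((n : ℝ) - w) / (Nat.factorial w)) *
                iteratedDerivWithin (w - 1) g (Set.Icc α β) α *
                ((∑ j, a j * (x j - α) ^ w) - ∑ i, b i * (y i - α) ^ w)) ∧
    ((∀ t ∈ Set.Icc α β,
        (∑ j, a j * (x j - t) ^ (n - 1) * k t (x j))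
              - (∑ i, b i * (y i - t) ^ (n - 1) * k t (y i)) ≤ 0) →
      (∑ j, a j * f (x j)) - (∑ i, b i * f (y i))
          - c * ((∑ j, a j * x j ^ n) - ∑ i, b i * y i ^ n) ≤
        (1 / (β - α)) * ∑ w ∈ Finset.Icc 2 (n - 1),
            (((n : ℝ) - w) / (Nat.factorial w)) *
              iteratedDerivWithin (w - 1) g (Set.Icc α β) β *
              ((∑ j, a j * (x j - β) ^ w) - ∑ i, b i * (y i - β) ^ w)
          - (1 / (β - α)) * ∑ w ∈ Finset.Icc 2 (n - 1),
              (((n : ℝ) - w) / (Nat.factorial w)) *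
                iteratedDerivWithin (w - 1) g (Set.Icc α β) α *
                ((∑ j, a j * (x j - α) ^ w) - ∑ i, b i * (y i - α) ^ w)) := by
  obtain ⟨N, rfl⟩ : ∃ N, n = N + 1 := ⟨n - 1, by omega⟩
  have hN : 1 ≤ N := by omega
  have hs : UniqueDiffOn ℝ (Set.Icc α β) := uniqueDiffOn_Icc hαβ
  obtain rfl : g = f - fun u ↦ c * u ^ (N + 1) := funext hg
  set g := f - fun u ↦ c * u ^ (N + 1) with hgdef
  have hpow : ContDiffOn ℝ (N + 1 : ℕ) (fun u : ℝ ↦ c * u ^ (N + 1)) (Set.Icc α β) := by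
    fun_prop
  have hgC : ContDiffOn ℝ (N + 1 : ℕ) g (Set.Icc α β) := hf.sub hpow
  have hnonneg : ∀ t ∈ Set.Icc α β, 0 ≤ iteratedDerivWithin (N + 1) g (Set.Icc α β) t := by
    intro t ht
    rw [hgdef, iteratedDerivWithin_sub ht hs (hf t ht) (hpow t ht),
      iteratedDerivWithin_const_mul_field, iteratedDerivWithin_pow ht hs,
      Nat.descFactorial_self]
    simpa using hfn t ht
  have hderiv : ∀ i < N + 1, ∀ t ∈ Set.Icc α β,
      HasDerivWithinAt (iteratedDerivWithin i g (Set.Icc α β))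
        (iteratedDerivWithin (i + 1) g (Set.Icc α β) t) (Set.Icc α β) t := fun i hi t ht ↦ by
    rw [iteratedDerivWithin_succ]
    exact (hgC.differentiableOn_iteratedDerivWithin (by exact_mod_cast hi) hs t ht).hasDerivWithinAt
  have hcont : ∀ i ≤ N + 1, ContinuousOn (iteratedDerivWithin i g (Set.Icc α β)) (Set.Icc α β) :=
    fun i hi ↦ hgC.continuousOn_iteratedDerivWithin (by exact_mod_cast hi) hs
  have hab : ∑ j, a j = ∑ i, b i := by
    simp only [haA]
    rw [Finset.sum_comm]
    simp only [← Finset.mul_sum, hArow, mul_one]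
  have hxy : ∑ j, a j * x j = ∑ i, b i * y i := by
    simp only [haA, hyA, Finset.sum_mul, Finset.mul_sum]
    rw [Finset.sum_comm]
    simp only [mul_assoc]
  have hfink := fink_identity_sum (z := Sum.elim x y) (q := Sum.elim a (fun i ↦ -b i))
    (by rintro (j | i); exacts [hx j, hy i]) (by simp [hab]) (by simp [hxy]) hk N hN hderiv hcont
  simp only [Fintype.sum_sum_type, Sum.elim_inl, Sum.elim_inr, neg_mul, Finset.sum_neg_distrib,
    ← sub_eq_add_neg, iteratedDerivWithin_zero] at hfink
  have hgsum : (∑ j, a j * g (x j)) - ∑ i, b i * g (y i)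
      = (∑ j, a j * f (x j)) - (∑ i, b i * f (y i))
          - c * ((∑ j, a j * x j ^ (N + 1)) - ∑ i, b i * y i ^ (N + 1)) := by
    simp only [hgdef, Pi.sub_apply, mul_sub, Finset.sum_sub_distrib, Finset.mul_sum,
      mul_left_comm c]
    ring
  rw [hgsum] at hfink
  have hfact : (0 : ℝ) < N.factorial := by positivity
  have hβα : 0 < β - α := sub_pos.2 hαβ
  have hsplit : ∀ P Q : ℕ → ℝ, ∑ w ∈ Finset.Icc 2 N, ((N + 1 : ℝ) - w) / (w.factorial : ℝ) *
      (iteratedDerivWithin (w - 1) g (Set.Icc α β) α * P w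
        - iteratedDerivWithin (w - 1) g (Set.Icc α β) β * Q w)
      = (∑ w ∈ Finset.Icc 2 N, ((N + 1 : ℝ) - w) / (w.factorial : ℝ) *
          iteratedDerivWithin (w - 1) g (Set.Icc α β) α * P w)
        - ∑ w ∈ Finset.Icc 2 N, ((N + 1 : ℝ) - w) / (w.factorial : ℝ) *
          iteratedDerivWithin (w - 1) g (Set.Icc α β) β * Q w := fun P Q ↦ by
    rw [← Finset.sum_sub_distrib]
    exact Finset.sum_congr rfl fun w _ ↦ by ring
  rw [hsplit (fun w ↦ (∑ j, a j * (x j - α) ^ w) - ∑ i, b i * (y i - α) ^ w)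
    (fun w ↦ (∑ j, a j * (x j - β) ^ w) - ∑ i, b i * (y i - β) ^ w)] at hfink
  simp only [Nat.add_sub_cancel, Nat.cast_add, Nat.cast_one]
  refine ⟨fun hker ↦ ?_, fun hker ↦ ?_⟩
  · have hint := intervalIntegral.integral_nonneg (μ := MeasureTheory.volume) hαβ.le
      fun t ht ↦ mul_nonneg (hker t ht) (hnonneg t ht)
    rw [hfink] at hint
    have := nonneg_of_mul_nonneg_right hint hfact
    rw [ge_iff_le, ← mul_sub, one_div_mul_eq_div, div_le_iff₀' hβα]
    linarith
  · have hint := intervalIntegral.integral_nonneg (μ := MeasureTheory.volume) hαβ.le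
      fun t ht ↦ neg_nonneg.2 (mul_nonpos_of_nonpos_of_nonneg (hker t ht) (hnonneg t ht))
    rw [intervalIntegral.integral_neg, hfink, ← mul_neg] at hint
    have := nonneg_of_mul_nonneg_right hint hfact
    rw [← mul_sub, one_div_mul_eq_div, le_div_iff₀' hβα]
    linarith
end

section
/- Let α < β, let n ≥ 2 be even, and let x = (x₁,…,x_l) ∈ [α,β]^l, y = (y₁,…,y_m) ∈ [α,β]^m, a ∈ [0,∞)^l, b ∈ [0,∞)^m be such that (y,b) ≺ (x,a) in the weighted majorization sense. Then for every fixed t ∈ [α,β], Σ_{j=1}^l a_j (x_j − t)^{n−1} k(t, x_j) − Σ_{i=1}^m b_i (y_i − t)^{n−1} k(t, y_i) ≥ 0, where k is the Fink kernel on [α,β]; in particular, for even n the function s(x) = (x − t)^{n−1} k(t, x) is convex on [α,β]. -/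
/-- Sherman's inequality for a convex function under weighted majorization. -/
theorem ConvexOn.sherman_inequality {ι κ : Type*} [Fintype ι] [Fintype κ] {s : Set ℝ} {f : ℝ → ℝ}
    (hf : ConvexOn ℝ s f) {x a : κ → ℝ} {y b : ι → ℝ} {A : ι → κ → ℝ}
    (hx : ∀ j, x j ∈ s) (hb : ∀ i, 0 ≤ b i) (hA : ∀ i j, 0 ≤ A i j)
    (hArow : ∀ i, ∑ j, A i j = 1) (haA : ∀ j, a j = ∑ i, b i * A i j)
    (hyA : ∀ i, y i = ∑ j, A i j * x j) :
    ∑ i, b i * f (y i) ≤ ∑ j, a j * f (x j) := by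
  have hjensen (i : ι) : f (y i) ≤ ∑ j, A i j * f (x j) := by
    simpa [hyA i] using
      hf.map_sum_le (t := Finset.univ) (fun j _ => hA i j) (hArow i) (fun j _ => hx j)
  calc ∑ i, b i * f (y i) ≤ ∑ i, b i * ∑ j, A i j * f (x j) :=
        Finset.sum_le_sum fun i _ => mul_le_mul_of_nonneg_left (hjensen i) (hb i)
    _ = ∑ j, a j * f (x j) := by
        simp only [haA, Finset.mul_sum, Finset.sum_mul, mul_assoc]
        exact Finset.sum_comm

/-- Nonnegative combinations of the truncated powers `(u - t)₊ ^ p` and `(t - u)₊ ^ p` are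
convex. -/
theorem convexOn_max_pow_add_max_pow (t : ℝ) {c d : ℝ} (hc : 0 ≤ c) (hd : 0 ≤ d) (p : ℕ) :
    ConvexOn ℝ Set.univ (fun u : ℝ => c * max (u - t) 0 ^ p + d * max (t - u) 0 ^ p) := by
  have hzero : ConvexOn ℝ Set.univ (fun _ : ℝ => (0 : ℝ)) := convexOn_const 0 convex_univ
  have hright : ConvexOn ℝ Set.univ (fun u : ℝ => u - t) :=
    (convexOn_id convex_univ).sub (concaveOn_const t convex_univ)
  have hleft : ConvexOn ℝ Set.univ (fun u : ℝ => t - u) :=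
    (convexOn_const t convex_univ).sub (concaveOn_id convex_univ)
  exact (((hright.sup hzero).pow (fun _ _ => le_max_right _ _) p).smul hc).add
    (((hleft.sup hzero).pow (fun _ _ => le_max_right _ _) p).smul hd)

/-- For even n the Fink-kernel function is convex and the Sherman-type kernel
expression is nonnegative. -/
theorem fink_kernel_nonneg_even
    (α β : ℝ) (hαβ : α < β) (n l m : ℕ) (hn : 2 ≤ n) (hneven : Even n)
    (x : Fin l → ℝ) (hx : ∀ j, x j ∈ Set.Icc α β)
    (y : Fin m → ℝ) (hy : ∀ i, y i ∈ Set.Icc α β)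
    (a : Fin l → ℝ) (ha : ∀ j, 0 ≤ a j)
    (b : Fin m → ℝ) (hb : ∀ i, 0 ≤ b i)
    (A : Fin m → Fin l → ℝ) (hA : ∀ i j, 0 ≤ A i j) (hArow : ∀ i, ∑ j, A i j = 1)
    (haA : ∀ j, a j = ∑ i, b i * A i j) (hyA : ∀ i, y i = ∑ j, A i j * x j)
    (k : ℝ → ℝ → ℝ) (hk : ∀ t u, k t u = if t ≤ u then t - α else t - β)
    (t : ℝ) (ht : t ∈ Set.Icc α β) :
    ConvexOn ℝ (Set.Icc α β) (fun u => (u - t) ^ (n - 1) * k t u) ∧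
      0 ≤ (∑ j, a j * (x j - t) ^ (n - 1) * k t (x j))
            - ∑ i, b i * (y i - t) ^ (n - 1) * k t (y i) := by
  have hodd : Odd (n - 1) := Nat.Even.sub_odd (by omega) hneven odd_one
  have hconv : ConvexOn ℝ (Set.Icc α β) (fun u => (u - t) ^ (n - 1) * k t u) := by
    refine ((convexOn_max_pow_add_max_pow t (sub_nonneg.2 ht.1) (sub_nonneg.2 ht.2)
      (n - 1)).subset (Set.subset_univ _) (convex_Icc α β)).congr fun u _ => ?_
    rcases le_or_gt t u with h | h
    · simp [hk, h, hodd.pos.ne', mul_comm]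
    · have hneg : (u - t) ^ (n - 1) = -(t - u) ^ (n - 1) := by rw [← hodd.neg_pow, neg_sub]
      simp only [hk, h.not_ge, if_false, max_eq_right (sub_nonpos.2 h.le),
        max_eq_left (sub_nonneg.2 h.le), hneg, zero_pow hodd.pos.ne']
      ring
  refine ⟨hconv, sub_nonneg.2 ?_⟩
  simpa only [mul_assoc] using hconv.sherman_inequality hx hb hA hArow haA hyA
end
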